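/- arXiv:1407.0776 — 4 statements merged into one kernel-verified Lean document; each statement's English description precedes it below -/
import Mathlib

section
/- If $Q = (q_n)$ is a $1$-convergent basic sequence (i.e., $\sum_{n=1}^\infty 1/q_n < \infty$), then for Lebesgue-almost every real number $x$, the set $\mathscr{S}_Q(x) = \{E_1, E_2, E_3, \dots\}$ of digits appearing in the $Q$-Cantor series expansion of $x$ has natural density $0$ in $\mathbb{N}_0$. -/
open scoped Classical
open Filter MeasureTheory

noncomputable section

/-- Product of the first `n` bases of a basic sequence. -/
def cantorProd (q : ℕ → ℕ) (n : ℕ) : ℝ := ∏ i ∈ Finset.range n, (q i : ℝ)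

/-- `E` is the sequence of digits of the `Q`-Cantor series expansion of `x`
(the digit `E n` is the digit `E_{n+1}` of the paper, in base `q n = q_{n+1}`). -/
def IsCantorExp (q : ℕ → ℕ) (x : ℝ) (E : ℕ → ℕ) : Prop :=
  (∀ n, E n < q n) ∧ (∀ m, ∃ n, m ≤ n ∧ E n ≠ q n - 1) ∧
  x = (⌊x⌋ : ℝ) + ∑' n, (E n : ℝ) / cantorProd q (n + 1)

/-- Number of occurrences of the block `B` of length `k` among the first `n` digits. -/
def blockCount (E : ℕ → ℕ) (k : ℕ) (B : Fin k → ℕ) (n : ℕ) : ℕ :=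
  ((Finset.range (n + 1 - k)).filter (fun j => ∀ i : Fin k, E (j + i) = B i)).card

/-- `Q_n^{(k)}`. -/
def Qnk (q : ℕ → ℕ) (k n : ℕ) : ℝ :=
  ∑ j ∈ Finset.range n, 1 / ∏ i ∈ Finset.range k, (q (j + i) : ℝ)

/-- `x` is `Q`-normal of order `k`. -/
def QNormalOrder (q : ℕ → ℕ) (k : ℕ) (x : ℝ) : Prop :=
  ∃ E, IsCantorExp q x E ∧ ∀ B : Fin k → ℕ,
    Tendsto (fun n => (blockCount E k B n : ℝ) / Qnk q k n) atTop (nhds 1)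

/-- `x` is `Q`-ratio normal of order `k`. -/
def QRatioNormalOrder (q : ℕ → ℕ) (k : ℕ) (x : ℝ) : Prop :=
  ∃ E, IsCantorExp q x E ∧ ∀ B₁ B₂ : Fin k → ℕ,
    Tendsto (fun n => (blockCount E k B₁ n : ℝ) / (blockCount E k B₂ n : ℝ))
      atTop (nhds 1)

/-- A sequence of reals is uniformly distributed mod 1. -/
def UDMod1 (u : ℕ → ℝ) : Prop :=
  ∀ a b : ℝ, 0 ≤ a → a ≤ b → b ≤ 1 →
    Tendsto
      (fun N => (((Finset.range N).filter
          (fun n => Int.fract (u n) ∈ Set.Ico a b)).card : ℝ) / N)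
      atTop (nhds (b - a))

/-- `x` is `Q`-distribution normal. -/
def QDistNormal (q : ℕ → ℕ) (x : ℝ) : Prop :=
  UDMod1 (fun n => cantorProd q n * x)

/-- Natural number version of the product of the first bases. -/
def cprodN (q : ℕ → ℕ) (n : ℕ) : ℕ := ∏ i ∈ Finset.range n, q i

lemma cantorProd_eq (q : ℕ → ℕ) (n : ℕ) : cantorProd q n = (cprodN q n : ℝ) := by
  simp [cantorProd, cprodN]

lemma cprodN_pos (q : ℕ → ℕ) (hq : ∀ n, 2 ≤ q n) (n : ℕ) : 0 < cprodN q n :=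
  Finset.prod_pos (fun i _ => by have := hq i; omega)

lemma cprodN_succ (q : ℕ → ℕ) (n : ℕ) : cprodN q (n + 1) = cprodN q n * q n :=
  Finset.prod_range_succ _ _

lemma cprodN_dvd (q : ℕ → ℕ) {n m : ℕ} (h : n ≤ m) : cprodN q n ∣ cprodN q m :=
  Finset.prod_dvd_prod_of_subset _ _ _ (Finset.range_mono h)

/-- Indicator of `fract y ≤ c`. -/
def fInd (c : ℝ) (y : ℝ) : ℝ := Set.indicator {y : ℝ | Int.fract y ≤ c} (fun _ => (1 : ℝ)) y

lemma fInd_of_le {c y : ℝ} (h : Int.fract y ≤ c) : fInd c y = 1 := by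
  simp [fInd, h]

lemma fInd_of_gt {c y : ℝ} (h : c < Int.fract y) : fInd c y = 0 := by
  simp [fInd, h]

lemma fInd_nonneg (c y : ℝ) : 0 ≤ fInd c y := Set.indicator_nonneg (fun _ _ => zero_le_one) _

lemma fInd_le_one (c y : ℝ) : fInd c y ≤ 1 :=
  Set.indicator_le_self' (f := fun _ => (1 : ℝ)) (fun _ _ => zero_le_one) _

lemma fInd_mul_self (c y : ℝ) : fInd c y * fInd c y = fInd c y := by
  rcases le_or_gt (Int.fract y) c with h | h
  · simp [fInd_of_le h]
  · simp [fInd_of_gt h]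

lemma fInd_meas (c : ℝ) : Measurable (fInd c) :=
  measurable_const.indicator (measurableSet_le measurable_fract measurable_const)

lemma fInd_add_int (c y : ℝ) (z : ℤ) : fInd c (y + z) = fInd c y := by
  rcases le_or_gt (Int.fract y) c with h | h
  · rw [fInd_of_le h, fInd_of_le (by rwa [Int.fract_add_intCast])]
  · rw [fInd_of_gt h, fInd_of_gt (by rwa [Int.fract_add_intCast])]

lemma bdd_intervalIntegrable {g : ℝ → ℝ} (hg : Measurable g) (h : ∀ x, |g x| ≤ 1) (a b : ℝ) :
    IntervalIntegrable g volume a b :=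
  (intervalIntegrable_const (c := (1 : ℝ))).mono_fun hg.aestronglyMeasurable
    (Eventually.of_forall (fun x => by simpa using h x))

/-- Integral of a `1`-periodic function over `[0,a*K/(b*K)]` after dilation. -/
lemma integral_dilate {g : ℝ → ℝ} (hg : Measurable g) (h : ∀ x, |g x| ≤ 1)
    (hp : Function.Periodic g 1) (q K a : ℕ) (hq : 0 < q) (hK : 0 < K) :
    ∫ x in (0 : ℝ)..((a : ℝ) / q), g ((q * K : ℕ) * x) = (a : ℝ) / q * ∫ x in (0 : ℝ)..1, g x := by
  have hq' : (q : ℝ) ≠ 0 := by positivity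
  have hK' : (K : ℝ) ≠ 0 := by positivity
  rw [intervalIntegral.integral_comp_mul_left _ (by positivity)]
  have h1 := hp.intervalIntegral_add_zsmul_eq ((a * K : ℕ) : ℤ) 0 (bdd_intervalIntegrable hg h)
  have e : ((q * K : ℕ) : ℝ) * (a / q) = 0 + ((a * K : ℕ) : ℤ) • (1 : ℝ) := by
    simp; field_simp
  rw [e, mul_zero, h1]
  simp
  field_simp

lemma integral_dilate_one {g : ℝ → ℝ} (hg : Measurable g) (h : ∀ x, |g x| ≤ 1)
    (hp : Function.Periodic g 1) (K : ℕ) (hK : 0 < K) :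
    ∫ x in (0 : ℝ)..1, g (K * x) = ∫ x in (0 : ℝ)..1, g x := by
  simpa using integral_dilate hg h hp 1 K 1 one_pos hK

lemma integral_fInd_mul {g : ℝ → ℝ} (hg : Measurable g) (h : ∀ x, |g x| ≤ 1)
    {c : ℝ} (h0 : 0 ≤ c) (h1 : c ≤ 1) :
    ∫ x in (0 : ℝ)..1, fInd c x * g x = ∫ x in (0 : ℝ)..c, g x := by
  have hb : ∀ x, |fInd c x * g x| ≤ 1 := fun x => by
    rw [abs_mul, abs_of_nonneg (fInd_nonneg c x)]
    exact mul_le_one₀ (fInd_le_one c x) (abs_nonneg _) (h x)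
  have hi := bdd_intervalIntegrable (g := fun x => fInd c x * g x) ((fInd_meas c).mul hg) hb
  rw [← intervalIntegral.integral_add_adjacent_intervals (hi 0 c) (hi c 1)]
  have e1 : ∫ x in (0 : ℝ)..c, fInd c x * g x = ∫ x in (0 : ℝ)..c, g x := by
    apply intervalIntegral.integral_congr_Ioo_of_le h0
    intro x hx
    have : Int.fract x = x := Int.fract_eq_self.2 ⟨hx.1.le, hx.2.trans_le h1⟩
    simp only
    rw [fInd_of_le (by rw [this]; exact hx.2.le), one_mul]
  have e2 : ∫ x in c..1, fInd c x * g x = ∫ x in c..1, (0 : ℝ) := by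
    apply intervalIntegral.integral_congr_Ioo_of_le h1
    intro x hx
    have : Int.fract x = x := Int.fract_eq_self.2 ⟨h0.trans hx.1.le, hx.2⟩
    simp only
    rw [fInd_of_gt (by rw [this]; exact hx.1), zero_mul]
  simpa [e1] using e2

lemma fInd_abs (c y : ℝ) : |fInd c y| ≤ 1 := by
  rw [abs_of_nonneg (fInd_nonneg c y)]; exact fInd_le_one c y

lemma fInd_periodic (c : ℝ) : Function.Periodic (fInd c) 1 := fun y => by
  simpa using fInd_add_int c y 1

lemma integral_fInd {c : ℝ} (h0 : 0 ≤ c) (h1 : c ≤ 1) : ∫ x in (0 : ℝ)..1, fInd c x = c := by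
  have := integral_fInd_mul (g := fun _ => 1) measurable_const (by simp) h0 h1
  simpa using this

/-- Threshold `min (q n) N / q n`. -/
def thr (q : ℕ → ℕ) (N n : ℕ) : ℝ := ((min (q n) N : ℕ) : ℝ) / q n

lemma thr_nonneg (q : ℕ → ℕ) (N n : ℕ) : 0 ≤ thr q N n := by unfold thr; positivity

lemma thr_le_one (q : ℕ → ℕ) (N n : ℕ) : thr q N n ≤ 1 := by
  unfold thr
  apply div_le_one_of_le₀ _ (by positivity)
  exact_mod_cast min_le_left _ _

lemma thr_le (q : ℕ → ℕ) (N n : ℕ) : thr q N n ≤ N * (1 / q n) := by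
  unfold thr
  rw [mul_one_div]
  gcongr
  exact min_le_right _ _

/-- The indicator that digit `n` is (essentially) less than `N`. -/
def Xd (q : ℕ → ℕ) (N n : ℕ) (x : ℝ) : ℝ := fInd (thr q N n) (cprodN q n * x)

lemma Xd_meas (q : ℕ → ℕ) (N n : ℕ) : Measurable (Xd q N n) :=
  (fInd_meas _).comp (measurable_const.mul measurable_id)

lemma integral_Xd (q : ℕ → ℕ) (hq : ∀ n, 2 ≤ q n) (N n : ℕ) :
    ∫ x in (0 : ℝ)..1, Xd q N n x = thr q N n := by
  unfold Xd
  rw [integral_dilate_one (fInd_meas _) (fInd_abs _) (fInd_periodic _) _ (cprodN_pos q hq n),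
    integral_fInd (thr_nonneg _ _ _) (thr_le_one _ _ _)]

lemma integral_Xd_mul (q : ℕ → ℕ) (hq : ∀ n, 2 ≤ q n) (N : ℕ) {n m : ℕ} (hnm : n < m) :
    ∫ x in (0 : ℝ)..1, Xd q N n x * Xd q N m x = thr q N n * thr q N m := by
  obtain ⟨K, hK⟩ := cprodN_dvd q (Nat.succ_le_of_lt hnm)
  have hm := cprodN_pos q hq m
  have hKpos : 0 < K := by
    rcases Nat.eq_zero_or_pos K with h | h
    · rw [h] at hK; omega
    · exact h
  rw [Nat.succ_eq_add_one, cprodN_succ] at hK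
  have hqn : 0 < q n := by have := hq n; omega
  set c := thr q N n with hc
  set c' := thr q N m with hc'
  let g : ℝ → ℝ := fun y => fInd c' ((q n * K : ℕ) * y)
  have hgm : Measurable g := (fInd_meas _).comp (measurable_const.mul measurable_id)
  have hg1 : ∀ x, |g x| ≤ 1 := fun x => fInd_abs _ _
  let h : ℝ → ℝ := fun y => fInd c y * g y
  have hhp : Function.Periodic h 1 := by
    intro y
    have e : ((q n * K : ℕ) : ℝ) * (y + 1) = (q n * K : ℕ) * y + ((q n * K : ℕ) : ℤ) := by
      push_cast; ring
    simp only [h, g]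
    rw [fInd_periodic c y, e, fInd_add_int]
  have hh1 : ∀ x, |h x| ≤ 1 := fun x => by
    simp only [h]
    rw [abs_mul]
    exact mul_le_one₀ (fInd_abs _ _) (abs_nonneg _) (hg1 x)
  have e1 : ∀ x, Xd q N n x * Xd q N m x = h (cprodN q n * x) := by
    intro x
    simp only [h, g, Xd]
    rw [hK]
    push_cast
    congr 2
    ring
  simp_rw [e1]
  rw [integral_dilate_one (g := h) ((fInd_meas c).mul hgm) hh1 hhp _ (cprodN_pos q hq n),
    integral_fInd_mul hgm hg1 (thr_nonneg _ _ _) (thr_le_one _ _ _), hc, thr,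
    integral_dilate (fInd_meas c') (fInd_abs c') (fInd_periodic c') _ _ _ hqn hKpos,
    integral_fInd (thr_nonneg _ _ _) (thr_le_one _ _ _)]

lemma int_mul_centered (q : ℕ → ℕ) (hq : ∀ n, 2 ≤ q n) (N n m : ℕ) :
    ∫ x in (0 : ℝ)..1, (Xd q N n x - thr q N n) * (Xd q N m x - thr q N m)
      ≤ if n = m then thr q N n else 0 := by
  have hi : ∀ n, IntervalIntegrable (Xd q N n) volume 0 1 := fun n =>
    bdd_intervalIntegrable (Xd_meas q N n) (fun x => fInd_abs _ _) 0 1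
  have hii : IntervalIntegrable (fun x => Xd q N n x * Xd q N m x) volume 0 1 :=
    bdd_intervalIntegrable (g := fun x => Xd q N n x * Xd q N m x) ((Xd_meas q N n).mul (Xd_meas q N m)) (fun x => by
      rw [abs_mul]
      exact mul_le_one₀ (fInd_abs _ _) (abs_nonneg _) (fInd_abs _ _)) 0 1
  have e : ∫ x in (0 : ℝ)..1, (Xd q N n x - thr q N n) * (Xd q N m x - thr q N m)
      = (∫ x in (0 : ℝ)..1, Xd q N n x * Xd q N m x) - thr q N n * thr q N m := by
    have : ∀ x, (Xd q N n x - thr q N n) * (Xd q N m x - thr q N m) =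
        Xd q N n x * Xd q N m x - thr q N m * Xd q N n x - thr q N n * Xd q N m x
          + thr q N n * thr q N m := fun x => by ring
    simp_rw [this]
    rw [intervalIntegral.integral_add ((hii.sub ((hi n).const_mul _)).sub ((hi m).const_mul _))
        intervalIntegrable_const,
      intervalIntegral.integral_sub (hii.sub ((hi n).const_mul _)) ((hi m).const_mul _),
      intervalIntegral.integral_sub hii ((hi n).const_mul _),
      intervalIntegral.integral_const_mul, intervalIntegral.integral_const_mul,
      integral_Xd q hq, integral_Xd q hq]
    simp
    ring
  rw [e]
  rcases lt_trichotomy n m with h | h | h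
  · rw [integral_Xd_mul q hq N h, if_neg h.ne, sub_self]
  · subst h
    have : ∀ x, Xd q N n x * Xd q N n x = Xd q N n x := fun x => fInd_mul_self _ _
    simp_rw [this]
    simp only [integral_Xd q hq, if_true]
    nlinarith [mul_self_nonneg (thr q N n)]
  · simp_rw [mul_comm (Xd q N n _)]
    rw [integral_Xd_mul q hq N h, if_neg h.ne', mul_comm, sub_self]

lemma variance_bound (q : ℕ → ℕ) (hq : ∀ n, 2 ≤ q n) (N M : ℕ) :
    ∫ x in (0 : ℝ)..1, (∑ n ∈ Finset.range M, (Xd q N n x - thr q N n)) ^ 2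
      ≤ ∑ n ∈ Finset.range M, thr q N n := by
  have hi : ∀ n m, IntervalIntegrable
      (fun x => (Xd q N n x - thr q N n) * (Xd q N m x - thr q N m)) volume 0 1 := fun n m => by
    apply bdd_intervalIntegrable
      (g := fun x => (Xd q N n x - thr q N n) * (Xd q N m x - thr q N m))
      (((Xd_meas q N n).sub measurable_const).mul ((Xd_meas q N m).sub measurable_const))
    intro x
    have key : ∀ n, |Xd q N n x - thr q N n| ≤ 1 := fun n => by
      have a1 := thr_nonneg q N n
      have a2 := thr_le_one q N n
      have a3 : 0 ≤ Xd q N n x := fInd_nonneg _ _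
      have a4 : Xd q N n x ≤ 1 := fInd_le_one _ _
      rw [abs_le]; constructor <;> linarith
    rw [abs_mul]
    exact mul_le_one₀ (key n) (abs_nonneg _) (key m)
  simp_rw [sq, Finset.sum_mul_sum]
  rw [intervalIntegral.integral_finsetSum
    (fun n _ => by
      have := IntervalIntegrable.sum (μ := volume) (a := 0) (b := 1) (Finset.range M)
        (f := fun m x => (Xd q N n x - thr q N n) * (Xd q N m x - thr q N m)) (fun m _ => hi n m)
      simpa [Finset.sum_fn] using this)]
  apply Finset.sum_le_sum
  intro n hn
  rw [intervalIntegral.integral_finsetSum (fun m _ => hi n m)]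
  refine (Finset.sum_le_sum (fun m _ => int_mul_centered q hq N n m)).trans ?_
  rw [Finset.sum_ite_eq, if_pos hn]

lemma mean_bound (q : ℕ → ℕ) (hconv : Summable (fun n => (1 : ℝ) / q n)) {ε : ℝ} (hε : 0 < ε) :
    ∀ᶠ N : ℕ in atTop, ∀ M, ∑ n ∈ Finset.range M, thr q N n ≤ ε * N := by
  obtain ⟨s, hs⟩ := summable_iff_vanishing_norm.1 hconv (ε / 2) (by positivity)
  filter_upwards [tendsto_natCast_atTop_atTop.eventually_ge_atTop ((s.card : ℝ) / (ε / 2))]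
    with N hN M
  rw [div_le_iff₀ (by positivity)] at hN
  rw [← Finset.sum_filter_add_sum_filter_not _ (fun n => n ∈ s)]
  have h1 : ∑ n ∈ (Finset.range M).filter (fun n => n ∈ s), thr q N n ≤ s.card := by
    refine (Finset.sum_le_card_nsmul _ _ 1 (fun n _ => thr_le_one q N n)).trans ?_
    rw [nsmul_eq_mul, mul_one]
    exact_mod_cast Finset.card_le_card (fun n hn => (Finset.mem_filter.1 hn).2)
  have h2 : ∑ n ∈ (Finset.range M).filter (fun n => ¬ n ∈ s), thr q N n ≤ N * (ε / 2) := by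
    refine (Finset.sum_le_sum (fun n _ => thr_le q N n)).trans ?_
    rw [← Finset.mul_sum]
    gcongr
    have := hs ((Finset.range M).filter (fun n => ¬ n ∈ s))
      (Finset.disjoint_left.2 (fun n hn => (Finset.mem_filter.1 hn).2))
    exact (le_abs_self _).trans this.le
  linarith

lemma total_bound (q : ℕ → ℕ) (hconv : Summable (fun n => (1 : ℝ) / q n)) (N M : ℕ) :
    ∑ n ∈ Finset.range M, thr q N n ≤ N * ∑' n, (1 : ℝ) / q n := by
  refine (Finset.sum_le_sum (fun n _ => thr_le q N n)).trans ?_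
  rw [← Finset.mul_sum]
  gcongr
  exact hconv.sum_le_tsum _ (fun n _ => by positivity)

lemma cheb (q : ℕ → ℕ) (hq : ∀ n, 2 ≤ q n) (hconv : Summable (fun n => (1 : ℝ) / q n))
    {ε : ℝ} (hε : 0 < ε) {N : ℕ} (hN : 0 < N)
    (hmean : ∀ M, ∑ n ∈ Finset.range M, thr q N n ≤ ε * N) :
    (volume.restrict (Set.Ioc (0 : ℝ) 1))
      {x | ∃ M, 2 * ε * N ≤ ∑ n ∈ Finset.range M, Xd q N n x}
      ≤ ENNReal.ofReal ((∑' n, (1 : ℝ) / q n) / ε ^ 2 * (1 / N)) := by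
  set μ := volume.restrict (Set.Ioc (0 : ℝ) 1) with hμ
  have : {x | ∃ M, 2 * ε * N ≤ ∑ n ∈ Finset.range M, Xd q N n x}
      = ⋃ M, {x | 2 * ε * N ≤ ∑ n ∈ Finset.range M, Xd q N n x} := by
    ext x; simp
  rw [this, Monotone.measure_iUnion]
  · apply iSup_le
    intro M
    have hN' : (0 : ℝ) < N := by exact_mod_cast hN
    let F : ℝ → ℝ := fun x => (∑ n ∈ Finset.range M, (Xd q N n x - thr q N n)) ^ 2
    have hFm : Measurable F := by
      apply Measurable.pow_const
      exact Finset.measurable_fun_sum _ (fun n _ => (Xd_meas q N n).sub measurable_const)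
    have hFb : ∀ x, |F x| ≤ (M : ℝ) ^ 2 := by
      intro x
      simp only [F]
      rw [abs_pow]
      gcongr
      refine (Finset.abs_sum_le_sum_abs _ _).trans ?_
      refine (Finset.sum_le_card_nsmul _ _ 1 ?_).trans (by simp)
      intro n _
      have a1 := thr_nonneg q N n
      have a2 := thr_le_one q N n
      have a3 : 0 ≤ Xd q N n x := fInd_nonneg _ _
      have a4 : Xd q N n x ≤ 1 := fInd_le_one _ _
      rw [abs_le]; constructor <;> linarith
    have hFi : Integrable F μ :=
      Integrable.of_bound hFm.aestronglyMeasurable _ (Eventually.of_forall hFb)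
    have hM := mul_meas_ge_le_integral_of_nonneg (μ := μ) (f := F)
      (Eventually.of_forall (fun x => sq_nonneg _)) hFi ((ε * N) ^ 2)
    have hV : ∫ x, F x ∂μ ≤ N * ∑' n, (1 : ℝ) / q n := by
      have := (variance_bound q hq N M).trans (total_bound q hconv N M)
      rwa [intervalIntegral.integral_of_le zero_le_one] at this
    have hsub : {x | 2 * ε * N ≤ ∑ n ∈ Finset.range M, Xd q N n x} ⊆ {x | (ε * N) ^ 2 ≤ F x} := by
      intro x hx
      simp only [Set.mem_ofPred_eq, F] at hx ⊢
      rw [Finset.sum_sub_distrib]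
      have := hmean M
      gcongr
      linarith
    refine (measure_mono hsub).trans ?_
    rw [← ofReal_measureReal]
    apply ENNReal.ofReal_le_ofReal
    have h2 := hM.trans hV
    have : (∑' n, (1 : ℝ) / q n) / ε ^ 2 * (1 / N) = (N * ∑' n, (1 : ℝ) / q n) / (ε * N) ^ 2 := by
      field_simp
    rw [this, le_div_iff₀ (by positivity), mul_comm]
    exact h2
  · intro M M' h x hx
    simp only [Set.mem_ofPred_eq] at hx ⊢
    exact hx.trans (Finset.sum_le_sum_of_subset_of_nonneg (Finset.range_mono h)
      (fun n _ _ => fInd_nonneg _ _))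

/-- The good event. -/
def Good (q : ℕ → ℕ) (x : ℝ) : Prop :=
  ∀ j : ℕ, ∀ᶠ k : ℕ in atTop, ∀ M,
    ∑ n ∈ Finset.range M, Xd q (2 ^ k) n x < 2 * (1 / ((j : ℝ) + 1)) * (2 ^ k : ℕ)

lemma ae_good_unit (q : ℕ → ℕ) (hq : ∀ n, 2 ≤ q n) (hconv : Summable (fun n => (1 : ℝ) / q n)) :
    ∀ᵐ x ∂(volume.restrict (Set.Ioc (0 : ℝ) 1)), Good q x := by
  unfold Good
  rw [ae_all_iff]
  intro j
  have hε : (0 : ℝ) < 1 / ((j : ℝ) + 1) := by positivity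
  set ε : ℝ := 1 / ((j : ℝ) + 1)
  have hpow : Tendsto (fun k : ℕ => 2 ^ k) atTop atTop :=
    tendsto_pow_atTop_atTop_of_one_lt (by norm_num : 1 < 2)
  obtain ⟨k0, hk0⟩ := eventually_atTop.1 (hpow.eventually (mean_bound q hconv hε))
  let T := ∑' n, (1 : ℝ) / q n
  have hT : 0 ≤ T := tsum_nonneg (fun n => by positivity)
  have hb := ae_eventually_notMem (μ := volume.restrict (Set.Ioc (0 : ℝ) 1))
    (s := fun k => {x | ∃ M, 2 * ε * (2 ^ (k + k0) : ℕ)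
      ≤ ∑ n ∈ Finset.range M, Xd q (2 ^ (k + k0)) n x}) (by
    have hs : Summable (fun k : ℕ => T / ε ^ 2 * (1 / ((2 ^ (k + k0) : ℕ) : ℝ))) := by
      apply Summable.mul_left
      have := (summable_nat_add_iff k0).2
        (summable_geometric_of_lt_one (r := (1 / 2 : ℝ)) (by norm_num) (by norm_num))
      simpa using this
    refine ne_top_of_le_ne_top ?_ (ENNReal.tsum_le_tsum
      (fun k => cheb q hq hconv hε (N := 2 ^ (k + k0)) (by positivity) (hk0 _ (by omega))))
    exact hs.tsum_ofReal_ne_top)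
  filter_upwards [hb] with x hx
  obtain ⟨k1, hk1⟩ := eventually_atTop.1 hx
  refine eventually_atTop.2 ⟨k1 + k0, fun k hk M => ?_⟩
  have h3 := hk1 (k - k0) (by omega)
  rw [Nat.sub_add_cancel (by omega)] at h3
  exact not_le.1 (fun h4 => h3 ⟨M, h4⟩)

lemma good_periodic (q : ℕ → ℕ) (x : ℝ) (z : ℤ) (h : Good q (x - z)) : Good q x := by
  have : ∀ N n, Xd q N n (x - z) = Xd q N n x := fun N n => by
    unfold Xd
    have e : (cprodN q n : ℝ) * (x - z) = cprodN q n * x + ((-(cprodN q n * z) : ℤ) : ℝ) := by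
      push_cast; ring
    rw [e, fInd_add_int]
  unfold Good at h ⊢
  simpa only [this] using h

lemma ae_good (q : ℕ → ℕ) (hq : ∀ n, 2 ≤ q n) (hconv : Summable (fun n => (1 : ℝ) / q n)) :
    ∀ᵐ x : ℝ, Good q x := by
  have h := (ae_restrict_iff' measurableSet_Ioc).1 (ae_good_unit q hq hconv)
  have h2 : ∀ᵐ x : ℝ, ∀ z : ℤ, (x - z) ∈ Set.Ioc (0 : ℝ) 1 → Good q (x - z) := by
    rw [ae_all_iff]
    intro z
    exact (measurePreserving_sub_right volume (z : ℝ)).quasiMeasurePreserving.ae h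
  filter_upwards [h2] with x hx
  apply good_periodic q x (⌈x⌉ - 1)
  apply hx
  have h1 := Int.le_ceil x
  have h2 := Int.ceil_lt_add_one x
  push_cast
  constructor <;> linarith

lemma digit_sum_bound (q : ℕ → ℕ) (hq : ∀ n, 2 ≤ q n) (E : ℕ → ℕ) (hE : ∀ n, E n < q n) (n M : ℕ) :
    ∑ j ∈ Finset.range M, (E (j + n) : ℝ) / cprodN q (j + n + 1) ≤
      1 / cprodN q n - 1 / cprodN q (M + n) := by
  induction M with
  | zero => simp
  | succ M ih =>
    rw [Finset.sum_range_succ]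
    have hp : (0 : ℝ) < cprodN q (M + n) := by exact_mod_cast cprodN_pos q hq _
    have hqp : (0 : ℝ) < q (M + n) := by
      have := hq (M + n); exact_mod_cast (by omega : 0 < q (M + n))
    have hEE : (E (M + n) : ℝ) + 1 ≤ q (M + n) := by exact_mod_cast hE (M + n)
    have e : (E (M + n) : ℝ) / cprodN q (M + n + 1) ≤
        1 / cprodN q (M + n) - 1 / cprodN q (M + 1 + n) := by
      rw [show M + 1 + n = M + n + 1 by ring, cprodN_succ]
      push_cast
      have : (1 : ℝ) / cprodN q (M + n) = q (M + n) / (cprodN q (M + n) * q (M + n)) := by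
        field_simp
      rw [this, ← sub_div]
      gcongr
      linarith
    linarith

lemma fract_bound (q : ℕ → ℕ) (hq : ∀ n, 2 ≤ q n) (x : ℝ) (E : ℕ → ℕ) (h : IsCantorExp q x E)
    (n : ℕ) : Int.fract (cprodN q n * x) ≤ ((E n : ℝ) + 1) / q n := by
  obtain ⟨hE, -, hx⟩ := h
  simp_rw [cantorProd_eq] at hx
  set a : ℕ → ℝ := fun n => (E n : ℝ) / cprodN q (n + 1) with ha
  have ha0 : ∀ n, 0 ≤ a n := fun n => by simp only [ha]; positivity
  have hpart : ∀ n M, ∑ j ∈ Finset.range M, a (j + n) ≤ 1 / cprodN q n := fun n M => by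
    refine (digit_sum_bound q hq E hE n M).trans ?_
    have : (0 : ℝ) ≤ 1 / cprodN q (M + n) := by positivity
    linarith
  have hsum : Summable a :=
    summable_of_sum_range_le ha0 (fun M => by simpa using hpart 0 M)
  have htail : ∑' j, a (j + (n + 1)) ≤ 1 / cprodN q (n + 1) :=
    Real.tsum_le_of_sum_range_le (fun j => ha0 _) (hpart (n + 1))
  have htail0 : 0 ≤ ∑' j, a (j + (n + 1)) := tsum_nonneg (fun j => ha0 _)
  have hsplit := hsum.sum_add_tsum_nat_add (n + 1)
  rw [Finset.sum_range_succ] at hsplit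
  set r := ∑' j, a (j + (n + 1)) with hr
  have hp : (0 : ℝ) < cprodN q n := by exact_mod_cast cprodN_pos q hq _
  have hqp : (0 : ℝ) < q n := by
    have := hq n; exact_mod_cast (by omega : 0 < q n)
  have hint : ∃ z : ℤ, (cprodN q n : ℝ) * ∑ j ∈ Finset.range n, a j = z := by
    refine ⟨((∑ j ∈ Finset.range n, E j * (cprodN q n / cprodN q (j + 1)) : ℕ) : ℤ), ?_⟩
    rw [Finset.mul_sum]
    push_cast
    apply Finset.sum_congr rfl
    intro j hj
    have hd := cprodN_dvd q (Nat.succ_le_of_lt (Finset.mem_range.1 hj))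
    have hp' : (cprodN q (j + 1) : ℝ) ≠ 0 := by
      exact_mod_cast (cprodN_pos q hq _).ne'
    rw [← Int.natCast_div, Int.cast_natCast, Nat.cast_div hd hp']
    simp only [ha]
    ring
  obtain ⟨z, hz⟩ := hint
  have e : (cprodN q n : ℝ) * x = (cprodN q n * (a n + r)) + ((cprodN q n * ⌊x⌋ + z : ℤ) : ℝ) := by
    conv_lhs => rw [hx]
    rw [← hsplit]
    push_cast
    rw [← hz]
    ring
  rw [e, Int.fract_add_intCast]
  have hnn : 0 ≤ (cprodN q n : ℝ) * (a n + r) := mul_nonneg hp.le (add_nonneg (ha0 n) htail0)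
  have h1 : Int.fract ((cprodN q n : ℝ) * (a n + r)) ≤ (cprodN q n : ℝ) * (a n + r) := by
    have : (0 : ℝ) ≤ ⌊(cprodN q n : ℝ) * (a n + r)⌋ := by exact_mod_cast Int.floor_nonneg.2 hnn
    rw [Int.fract]; linarith
  refine h1.trans ?_
  calc (cprodN q n : ℝ) * (a n + r) ≤ cprodN q n * (a n + 1 / cprodN q (n + 1)) := by gcongr
    _ = ((E n : ℝ) + 1) / q n := by
      simp only [ha, cprodN_succ]
      push_cast
      field_simp

lemma Xd_eq_one (q : ℕ → ℕ) (hq : ∀ n, 2 ≤ q n) (x : ℝ) (E : ℕ → ℕ) (h : IsCantorExp q x E)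
    (N n : ℕ) (hn : E n < N) : Xd q N n x = 1 := by
  apply fInd_of_le
  refine (fract_bound q hq x E h n).trans ?_
  unfold thr
  gcongr
  have := h.1 n
  exact_mod_cast (le_min (by omega) (by omega) : E n + 1 ≤ min (q n) N)

lemma card_le_sum (q : ℕ → ℕ) (hq : ∀ n, 2 ≤ q n) (x : ℝ) (E : ℕ → ℕ) (h : IsCantorExp q x E)
    (N N' : ℕ) (hN : N ≤ N') : ∃ M, (((Finset.range N).filter
            (fun d => ∃ n, E n = d)).card : ℝ) ≤ ∑ n ∈ Finset.range M, Xd q N' n x := by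
  set D := (Finset.range N).filter (fun d => ∃ n, E n = d) with hD
  have hch : ∀ d, ∃ n, d ∈ D → E n = d := fun d => by
    by_cases hd : d ∈ D
    · obtain ⟨n, hn⟩ := (Finset.mem_filter.1 hd).2
      exact ⟨n, fun _ => hn⟩
    · exact ⟨0, fun h => absurd h hd⟩
  choose φ hφ using hch
  have hinj : Set.InjOn φ D := fun a ha b hb hab => by
    rw [← hφ a ha, ← hφ b hb, hab]
  refine ⟨(D.image φ).sup id + 1, ?_⟩
  have hsub : D.image φ ⊆ Finset.range ((D.image φ).sup id + 1) := fun n hn => by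
    rw [Finset.mem_range]
    exact Nat.lt_succ_of_le (Finset.le_sup (f := id) hn)
  refine le_trans ?_ (Finset.sum_le_sum_of_subset_of_nonneg hsub (fun n _ _ => fInd_nonneg _ _))
  rw [Finset.sum_image hinj, Finset.card_eq_sum_ones]
  push_cast
  apply Finset.sum_le_sum
  intro d hd
  rw [Xd_eq_one q hq x E h]
  rw [hφ d hd]
  exact (Finset.mem_range.1 (Finset.mem_filter.1 hd).1).trans_le hN

/-- Erdős–Rényi: for a `1`-convergent basic sequence, the set of digits
appearing in the `Q`-Cantor series expansion has natural density zero
for almost every `x`. -/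
theorem digitSet_density_zero (q : ℕ → ℕ) (hq : ∀ n, 2 ≤ q n)
    (hconv : Summable (fun n => (1 : ℝ) / q n)) :
    ∀ᵐ x : ℝ, ∀ E : ℕ → ℕ, IsCantorExp q x E →
      Tendsto
        (fun N => (((Finset.range N).filter
            (fun d => ∃ n, E n = d)).card : ℝ) / N)
        atTop (nhds 0) := by
  filter_upwards [ae_good q hq hconv] with x hx E hE
  rw [Metric.tendsto_atTop]
  intro ε hε
  obtain ⟨j, hj⟩ := exists_nat_one_div_lt (show (0 : ℝ) < ε / 4 by positivity)
  obtain ⟨k0, hk0⟩ := eventually_atTop.1 (hx j)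
  refine ⟨2 ^ k0, fun N hN => ?_⟩
  have hNpos : 0 < N := lt_of_lt_of_le (by positivity) hN
  have hlog : k0 ≤ Nat.log 2 N := Nat.le_log_of_pow_le (by norm_num) hN
  have hlo : 2 ^ Nat.log 2 N ≤ N := Nat.pow_log_le_self 2 hNpos.ne'
  have hhi : N < 2 ^ (Nat.log 2 N + 1) := Nat.lt_pow_succ_log_self (by norm_num) N
  obtain ⟨M, hM⟩ := card_le_sum q hq x E hE N _ hhi.le
  have h1 := hM.trans_lt (hk0 (Nat.log 2 N + 1) (by omega) M)
  have hN' : (0 : ℝ) < N := by exact_mod_cast hNpos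
  have hlo' : ((2 ^ (Nat.log 2 N + 1) : ℕ) : ℝ) ≤ 2 * N := by
    rw [pow_succ]; push_cast
    have : ((2 : ℝ) ^ Nat.log 2 N) ≤ N := by exact_mod_cast hlo
    linarith
  rw [Real.dist_eq, sub_zero, abs_of_nonneg (by positivity), div_lt_iff₀ hN']
  refine h1.trans_le ?_
  calc 2 * (1 / ((j : ℝ) + 1)) * ((2 ^ (Nat.log 2 N + 1) : ℕ) : ℝ)
      ≤ 2 * (ε / 4) * (2 * N) := by gcongr
    _ = ε * N := by ring
end
end

section
/- Let $Q = (q_n)$ be a $1$-convergent basic sequence. For $x$ with $Q$-Cantor series digits $E_1, E_2, \dots$, let $d_n(x)$ be the number of distinct values among $E_1, \dots, E_n$. Then for almost every real number $x$, $\lim_{n\to\infty} d_n(x)/n = 1$. -/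
open scoped Classical
open Filter MeasureTheory

noncomputable section

/-- Natural product of the first bases. -/
def natP (q : ℕ → ℕ) (n : ℕ) : ℕ := ∏ i ∈ Finset.range n, q i

lemma natP_succ (q : ℕ → ℕ) (n : ℕ) : natP q (n + 1) = natP q n * q n :=
  Finset.prod_range_succ _ _

lemma natP_pos (q : ℕ → ℕ) (hq : ∀ n, 2 ≤ q n) (n : ℕ) : 0 < natP q n :=
  Finset.prod_pos (fun i _ => by have := hq i; omega)

lemma natP_cast (q : ℕ → ℕ) (n : ℕ) : cantorProd q n = (natP q n : ℝ) := by
  simp [cantorProd, natP]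

lemma natP_dvd (q : ℕ → ℕ) {i k : ℕ} (h : i ≤ k) : natP q i ∣ natP q k :=
  Finset.prod_dvd_prod_of_subset _ _ _ (Finset.range_subset_range.2 h)

/-- The digit functions. -/
def dig (q : ℕ → ℕ) (k : ℕ) (x : ℝ) : ℤ :=
  ⌊(natP q (k + 1) : ℝ) * x⌋ - q k * ⌊(natP q k : ℝ) * x⌋

lemma measurable_dig (q : ℕ → ℕ) (k : ℕ) : Measurable (dig q k) := by
  unfold dig
  fun_prop

/-- The set where digit `k` repeats an earlier one. -/
def repSet (q : ℕ → ℕ) (k : ℕ) : Set ℝ := {x | ∃ j < k, dig q k x = dig q j x}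

lemma measurableSet_repSet (q : ℕ → ℕ) (k : ℕ) : MeasurableSet (repSet q k) := by
  have : repSet q k = ⋃ j ∈ Finset.range k, {x | dig q k x = dig q j x} := by
    ext x; simp [repSet]
  rw [this]
  exact Finset.measurableSet_biUnion _ fun j _ =>
    measurableSet_eq_fun (measurable_dig q k) (measurable_dig q j)

lemma floor_natP (q : ℕ → ℕ) (hq : ∀ n, 2 ≤ q n) {i k : ℕ} (h : i ≤ k) (x : ℝ) :
    ⌊(natP q i : ℝ) * x⌋ = ⌊(natP q k : ℝ) * x⌋ / ((natP q k / natP q i : ℕ) : ℤ) := by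
  obtain ⟨r, hr⟩ := natP_dvd q h
  have h1 := natP_pos q hq i
  have h2 := natP_pos q hq k
  have hr0 : 0 < r := by
    rcases Nat.eq_zero_or_pos r with h0 | h0
    · subst h0; omega
    · exact h0
  rw [hr, Nat.mul_div_cancel_left _ h1]
  rw [← Int.floor_div_natCast]
  congr 1
  push_cast
  field_simp

lemma vol_repSet (q : ℕ → ℕ) (hq : ∀ n, 2 ≤ q n) (k : ℕ) (m : ℤ) :
    volume (repSet q k ∩ Set.Ico (m : ℝ) (m + 1)) ≤ ENNReal.ofReal (k / q k) := by
  set D : ℕ → ℤ → ℤ := fun i N => N / ((natP q k / natP q i : ℕ) : ℤ) with hD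
  set c : ℕ → ℤ → ℤ := fun j N => D (j + 1) N - q j * D j N with hc
  have hPk := natP_pos q hq k
  have hPk1 := natP_pos q hq (k + 1)
  have hPkR : (0 : ℝ) < natP q k := by exact_mod_cast hPk
  have hPkR1 : (0 : ℝ) < natP q (k + 1) := by exact_mod_cast hPk1
  have hsub : repSet q k ∩ Set.Ico (m : ℝ) (m + 1) ⊆
      ⋃ N ∈ Finset.Ico (m * natP q k : ℤ) (m * natP q k + natP q k), ⋃ j ∈ Finset.range k,
        Set.Ico (((q k * N + c j N : ℤ) : ℝ) / natP q (k + 1))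
          (((q k * N + c j N : ℤ) + 1 : ℝ) / natP q (k + 1)) := by
    rintro x ⟨⟨j, hj, hjk⟩, hx1, hx2⟩
    simp only [Set.mem_iUnion]
    refine ⟨⌊(natP q k : ℝ) * x⌋, ?_, j, Finset.mem_range.2 hj, ?_⟩
    · rw [Finset.mem_Ico, Int.le_floor, Int.floor_lt]
      push_cast
      constructor <;> nlinarith
    · have e : (q k * ⌊(natP q k : ℝ) * x⌋ + c j ⌊(natP q k : ℝ) * x⌋ : ℤ)
          = ⌊(natP q (k + 1) : ℝ) * x⌋ := by
        simp only [hc, hD]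
        rw [← floor_natP q hq hj.le, ← floor_natP q hq (Nat.succ_le_of_lt hj)]
        unfold dig at hjk
        linarith
      rw [e, Set.mem_Ico, div_le_iff₀ hPkR1, lt_div_iff₀ hPkR1, mul_comm x]
      exact ⟨Int.floor_le _, Int.lt_floor_add_one _⟩
  refine (measure_mono hsub).trans ?_
  refine (measure_biUnion_finset_le _ _).trans ?_
  have hb : ∀ N ∈ Finset.Ico (m * natP q k : ℤ) (m * natP q k + natP q k),
      volume (⋃ j ∈ Finset.range k,
        Set.Ico (((q k * N + c j N : ℤ) : ℝ) / natP q (k + 1))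
          (((q k * N + c j N : ℤ) + 1 : ℝ) / natP q (k + 1))) ≤
        ENNReal.ofReal (k * (1 / natP q (k + 1))) := by
    intro N _
    refine (measure_biUnion_finset_le _ _).trans ?_
    rw [ENNReal.ofReal_mul (by positivity), ENNReal.ofReal_natCast]
    refine (Finset.sum_le_card_nsmul _ _ (ENNReal.ofReal (1 / natP q (k + 1))) ?_).trans ?_
    · intro j _
      rw [Real.volume_Ico]
      apply le_of_eq
      congr 1
      ring
    · simp
  refine (Finset.sum_le_card_nsmul _ _ _ hb).trans ?_
  rw [Int.card_Ico, nsmul_eq_mul, ← ENNReal.ofReal_natCast, ← ENNReal.ofReal_mul (by positivity)]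
  apply ENNReal.ofReal_le_ofReal
  simp only [add_sub_cancel_left, Int.toNat_natCast]
  rw [natP_succ]
  push_cast
  have : (0 : ℝ) < q k := by have := hq k; exact_mod_cast (by omega : 0 < q k)
  apply le_of_eq
  field_simp

lemma digits_eq (q : ℕ → ℕ) (hq : ∀ n, 2 ≤ q n) (x : ℝ) (hx : Irrational x) (E : ℕ → ℕ)
    (hE : IsCantorExp q x E) (k : ℕ) : (E k : ℤ) = dig q k x := by
  obtain ⟨hlt, -, hsum⟩ := hE
  simp only [natP_cast] at hsum
  have hP : ∀ n, (0 : ℝ) < natP q n := fun n => by exact_mod_cast natP_pos q hq n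
  have hq0 : ∀ n, (0 : ℝ) < q n := fun n => by
    have := hq n; exact_mod_cast (by omega : 0 < q n)
  set f : ℕ → ℝ := fun n => (E n : ℝ) / natP q (n + 1) with hf
  have hf0 : ∀ n, 0 ≤ f n := fun n => by positivity
  have hanti : Antitone (fun n => ∑ i ∈ Finset.range n, f i + 1 / (natP q n : ℝ)) := by
    apply antitone_nat_of_succ_le
    intro n
    rw [Finset.sum_range_succ]
    have h1 : (E n : ℝ) + 1 ≤ q n := by exact_mod_cast hlt n
    have h2 : f n + 1 / (natP q (n + 1) : ℝ) ≤ 1 / (natP q n : ℝ) := by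
      simp only [hf]
      rw [← add_div, div_le_div_iff₀ (hP _) (hP _), natP_succ]
      push_cast
      nlinarith [hP n]
    linarith
  have hub : ∀ n m, ∑ i ∈ Finset.range m, f i ≤
      ∑ i ∈ Finset.range n, f i + 1 / (natP q n : ℝ) := by
    intro n m
    have hpos : ∀ n, 0 < 1 / (natP q n : ℝ) := fun n => by have := hP n; positivity
    rcases le_total n m with h | h
    · have := hanti h
      simp only at this
      linarith [hpos m]
    · have := Finset.sum_le_sum_of_subset_of_nonneg (f := f) (Finset.range_subset_range.2 h)
        (fun i _ _ => hf0 i)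
      linarith [hpos n]
  have hs : Summable f := summable_of_sum_range_le hf0 (hub 0)
  have hle : ∀ n, ∑' i, f i ≤ ∑ i ∈ Finset.range n, f i + 1 / (natP q n : ℝ) := fun n =>
    Real.tsum_le_of_sum_range_le hf0 (hub n)
  have hge : ∀ n, ∑ i ∈ Finset.range n, f i ≤ ∑' i, f i := fun n =>
    hs.sum_le_tsum _ (fun i _ => hf0 i)
  have key : ∀ n, ((⌊(natP q n : ℝ) * x⌋ : ℤ) : ℝ) =
      natP q n * (⌊x⌋ + ∑ i ∈ Finset.range n, f i) := by
    intro n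
    have hZ : ∀ n, ∃ z : ℤ, (z : ℝ) = natP q n * (⌊x⌋ + ∑ i ∈ Finset.range n, f i) := by
      intro n
      induction n with
      | zero => exact ⟨⌊x⌋, by simp [natP]⟩
      | succ n ih =>
        obtain ⟨z, hz⟩ := ih
        refine ⟨q n * z + E n, ?_⟩
        have h3 : (natP q (n + 1) : ℝ) * f n = E n := by
          simp only [hf]
          have := hP (n + 1)
          field_simp
        rw [Finset.sum_range_succ, ← add_assoc, mul_add, h3, natP_succ]
        push_cast
        rw [hz]
        ring
    obtain ⟨z, hz⟩ := hZ n
    rw [← hz]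
    congr 1
    rw [Int.floor_eq_iff]
    have hxx : (natP q n : ℝ) * x = natP q n * (⌊x⌋ + ∑' i, f i) := by rw [← hsum]
    constructor
    · rw [hz, hxx]
      have := hge n
      have := hP n
      gcongr
    · apply lt_of_le_of_ne
      · rw [hz, hxx]
        have h4 := mul_le_mul_of_nonneg_left (hle n) (hP n).le
        have h5 : (natP q n : ℝ) * (1 / natP q n) = 1 := by
          have := hP n
          field_simp
        rw [mul_add, h5] at h4
        linarith
      · intro h
        have h6 : Irrational ((natP q n : ℝ) * x) :=
          hx.natCast_mul (natP_pos q hq n).ne'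
        apply h6.ne_int (z + 1)
        rw [h]; push_cast; rfl
  have : ((E k : ℤ) : ℝ) = ((dig q k x : ℤ) : ℝ) := by
    unfold dig
    push_cast
    rw [key, key, Finset.sum_range_succ]
    have h3 : (natP q (k + 1) : ℝ) * f k = E k := by
      simp only [hf]
      have := hP (k + 1)
      field_simp
    rw [← add_assoc, mul_add, h3, natP_succ]
    push_cast
    ring
  exact_mod_cast this

lemma ae_summable (q : ℕ → ℕ) (hq : ∀ n, 2 ≤ q n)
    (hconv : Summable (fun n => (1 : ℝ) / q n)) :
    ∀ᵐ x : ℝ, Summable (fun k : ℕ => (if x ∈ repSet q k then (1 : ℝ) else 0) / (k + 1)) := by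
  have hm : ∀ m : ℤ, ∀ᵐ x ∂(volume.restrict (Set.Ico (m : ℝ) (m + 1))),
      Summable (fun k : ℕ => (if x ∈ repSet q k then (1 : ℝ) else 0) / (k + 1)) := by
    intro m
    set g : ℕ → ℝ → ENNReal := fun k =>
      (repSet q k).indicator (fun _ => ENNReal.ofReal (1 / (k + 1))) with hg
    have hgm : ∀ k, Measurable (g k) := fun k =>
      measurable_const.indicator (measurableSet_repSet q k)
    have hfin : ∫⁻ x in Set.Ico (m : ℝ) (m + 1), ∑' k, g k x ≠ ⊤ := by
      rw [lintegral_tsum (fun k => (hgm k).aemeasurable)]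
      refine ne_top_of_le_ne_top hconv.tsum_ofReal_ne_top (ENNReal.tsum_le_tsum fun k => ?_)
      simp only [hg]
      rw [lintegral_indicator_const (measurableSet_repSet q k),
        Measure.restrict_apply (measurableSet_repSet q k)]
      refine (mul_le_mul_right (vol_repSet q hq k m) _).trans ?_
      rw [← ENNReal.ofReal_mul (by positivity)]
      apply ENNReal.ofReal_le_ofReal
      have : (0 : ℝ) < q k := by have := hq k; exact_mod_cast (by omega : 0 < q k)
      rw [div_mul_div_comm, div_le_div_iff₀ (by positivity) this]
      nlinarith
    filter_upwards [ae_lt_top (Measurable.tsum hgm) hfin] with x hx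
    have := ENNReal.summable_toReal hx.ne
    refine this.congr fun k => ?_
    simp only [hg, Set.indicator_apply]
    split_ifs
    · rw [ENNReal.toReal_ofReal (by positivity)]
    · simp
  have := (ae_restrict_iUnion_iff (μ := (volume : Measure ℝ))
    (fun m : ℤ => Set.Ico (m : ℝ) (m + 1)) _).2 hm
  rwa [iUnion_Ico_intCast, Measure.restrict_univ] at this

lemma kronecker (a : ℕ → ℝ) (ha : ∀ k, 0 ≤ a k)
    (hs : Summable (fun k : ℕ => a k / (k + 1))) :
    Tendsto (fun n : ℕ => (∑ k ∈ Finset.range n, a k) / n) atTop (nhds 0) := by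
  have h := tendsto_tsum_of_dominated_convergence (𝓕 := atTop) (f := fun (n : ℕ) (k : ℕ) =>
    if k < n then a k / n else 0) (g := fun _ => (0 : ℝ)) hs ?_ ?_
  · simp only [tsum_zero] at h
    refine h.congr fun n => ?_
    rw [tsum_eq_sum (s := Finset.range n)]
    · rw [Finset.sum_div]
      exact Finset.sum_congr rfl fun k hk => if_pos (Finset.mem_range.1 hk)
    · intro k hk
      exact if_neg (by simpa using hk)
  · intro k
    apply (tendsto_const_div_atTop_nhds_zero_nat (a k)).congr'
    filter_upwards [eventually_gt_atTop k] with n hn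
    rw [if_pos hn]
  · refine Eventually.of_forall fun n k => ?_
    split_ifs with hk
    · have := ha k
      rw [Real.norm_of_nonneg (by positivity)]
      have : (k : ℝ) + 1 ≤ n := by exact_mod_cast hk
      gcongr
    · have := ha k
      rw [norm_zero]
      positivity

lemma card_lower (E : ℕ → ℕ) (a : ℕ → ℝ) (ha : ∀ k, 0 ≤ a k)
    (h1 : ∀ k, (∃ j < k, E k = E j) → a k = 1) (n : ℕ) :
    (n : ℝ) ≤ ((Finset.range n).image E).card + ∑ k ∈ Finset.range n, a k := by
  induction n with
  | zero => simp
  | succ n ih =>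
    rw [Finset.sum_range_succ, Finset.range_add_one, Finset.image_insert]
    by_cases h : E n ∈ (Finset.range n).image E
    · rw [Finset.insert_eq_of_mem h]
      simp only [Finset.mem_image, Finset.mem_range] at h
      obtain ⟨j, hj, hjn⟩ := h
      rw [h1 n ⟨j, hj, hjn.symm⟩]
      push_cast
      linarith
    · rw [Finset.card_insert_of_notMem h]
      push_cast
      linarith [ha n]

/-- Erdős–Rényi: for a `1`-convergent basic sequence, almost every `x` has
asymptotically all of its first `n` digits distinct. -/
theorem distinct_digit_count_ae (q : ℕ → ℕ) (hq : ∀ n, 2 ≤ q n)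
    (hconv : Summable (fun n => (1 : ℝ) / q n)) :
    ∀ᵐ x : ℝ, ∀ E : ℕ → ℕ, IsCantorExp q x E →
      Tendsto (fun n => (((Finset.range n).image E).card : ℝ) / n)
        atTop (nhds 1) := by
  have hirr : ∀ᵐ x : ℝ, Irrational x := by
    have h : (Set.range ((↑) : ℚ → ℝ)).Countable := Set.countable_range _
    filter_upwards [h.ae_notMem volume] with x hx using hx
  filter_upwards [hirr, ae_summable q hq hconv] with x hx hs E hE
  have hd := digits_eq q hq x hx E hE
  set a : ℕ → ℝ := fun k => if x ∈ repSet q k then (1 : ℝ) else 0 with hadef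
  have ha : ∀ k, 0 ≤ a k := fun k => by simp only [hadef]; split_ifs <;> norm_num
  have hk := kronecker a ha hs
  have hlow := card_lower E a ha (fun k ⟨j, hj, hjk⟩ => if_pos ⟨j, hj, by
    rw [← hd, ← hd, hjk]⟩)
  have h1 : Tendsto (fun n : ℕ => 1 - (∑ k ∈ Finset.range n, a k) / n) atTop (nhds 1) := by
    simpa using hk.const_sub 1
  refine tendsto_of_tendsto_of_tendsto_of_le_of_le' h1 tendsto_const_nhds ?_ ?_
  · filter_upwards [eventually_gt_atTop 0] with n hn
    have hn' : (0 : ℝ) < n := by exact_mod_cast hn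
    rw [sub_le_iff_le_add, ← add_div, le_div_iff₀ hn', one_mul]
    exact hlow n
  · refine Eventually.of_forall fun n => ?_
    apply div_le_one_of_le₀ _ (Nat.cast_nonneg n)
    have := Finset.card_image_le (s := Finset.range n) (f := E)
    rw [Finset.card_range] at this
    exact_mod_cast this
end
end

section
/- For every basic sequence $Q$, the set $\mathscr{DN}(Q)$ of $Q$-distribution normal numbers has full Lebesgue measure. -/
open scoped Classical
open Filter MeasureTheory

noncomputable section

/-- Centered indicator of `[0,b)` mod 1. -/
def dnF (b : ℝ) (y : ℝ) : ℝ := (if Int.fract y < b then 1 else 0) - b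

lemma dnF_meas (b : ℝ) : Measurable (dnF b) := by
  unfold dnF
  exact (Measurable.ite (measurableSet_lt measurable_fract measurable_const)
    measurable_const measurable_const).sub_const b

lemma dnF_periodic (b : ℝ) : Function.Periodic (dnF b) 1 := by
  intro y; simp [dnF]

lemma dnF_abs {b : ℝ} (h0 : 0 ≤ b) (h1 : b ≤ 1) (y : ℝ) : |dnF b y| ≤ 1 := by
  unfold dnF
  split_ifs <;> rw [abs_le] <;> constructor <;> linarith

lemma bdd_ii {g : ℝ → ℝ} (hg : Measurable g) {C : ℝ} (hC : ∀ y, |g y| ≤ C) (s t : ℝ) :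
    IntervalIntegrable g volume s t := by
  refine (intervalIntegrable_const (c := C)).mono_fun hg.aestronglyMeasurable ?_
  refine Filter.Eventually.of_forall fun y => ?_
  simpa using (hC y).trans (le_abs_self C)

lemma dnF_mul_integral {b : ℝ} (h0 : 0 ≤ b) (h1 : b ≤ 1) {g : ℝ → ℝ} (hg : Measurable g)
    {C : ℝ} (hC : ∀ y, |g y| ≤ C) :
    ∫ y in (0:ℝ)..1, dnF b y * g y = (∫ y in (0:ℝ)..b, g y) - b * ∫ y in (0:ℝ)..1, g y := by
  have hi := fun s t => bdd_ii hg hC s t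
  have hfi : ∀ s t, IntervalIntegrable (fun y => dnF b y * g y) volume s t := fun s t =>
    bdd_ii (C := 1 * C) ((dnF_meas b).mul hg) (fun y => by
      rw [Pi.mul_apply, abs_mul]; exact mul_le_mul (dnF_abs h0 h1 y) (hC y) (abs_nonneg _) zero_le_one) s t
  rw [← intervalIntegral.integral_add_adjacent_intervals (hfi 0 b) (hfi b 1),
    ← intervalIntegral.integral_add_adjacent_intervals (hi 0 b) (hi b 1)]
  have e1 : ∫ y in (0:ℝ)..b, dnF b y * g y = ∫ y in (0:ℝ)..b, (1 - b) * g y := by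
    refine intervalIntegral.integral_congr_ae ?_
    have : ∀ᵐ y : ℝ, y ≠ b := by simp [ae_iff]
    filter_upwards [this] with y hy hy'
    rw [Set.uIoc_of_le h0] at hy'
    have hlt : y < b := lt_of_le_of_ne hy'.2 hy
    have : Int.fract y = y := Int.fract_eq_self.2 ⟨hy'.1.le, by linarith⟩
    simp [dnF, this, hlt]
  have e2 : ∫ y in b..1, dnF b y * g y = ∫ y in b..1, (- b) * g y := by
    refine intervalIntegral.integral_congr_ae ?_
    have : ∀ᵐ y : ℝ, y ≠ 1 := by simp [ae_iff]
    filter_upwards [this] with y hy hy'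
    rw [Set.uIoc_of_le h1] at hy'
    have hlt : y < 1 := lt_of_le_of_ne hy'.2 hy
    have : Int.fract y = y := Int.fract_eq_self.2 ⟨by linarith [hy'.1], by linarith⟩
    simp [dnF, this, not_lt.2 hy'.1.le]
  rw [e1, e2, intervalIntegral.integral_const_mul, intervalIntegral.integral_const_mul]
  ring

lemma dnF_integral {b : ℝ} (h0 : 0 ≤ b) (h1 : b ≤ 1) : ∫ y in (0:ℝ)..1, dnF b y = 0 := by
  have := dnF_mul_integral h0 h1 (g := fun _ => 1) measurable_const (C := 1) (by simp)
  simpa using this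

lemma dnF_prim {b : ℝ} (h0 : 0 ≤ b) (h1 : b ≤ 1) (T : ℝ) : |∫ y in (0:ℝ)..T, dnF b y| ≤ 1 := by
  have hi := fun s t => bdd_ii (dnF_meas b) (dnF_abs h0 h1) s t
  have e : ∫ y in (0:ℝ)..(⌊T⌋ : ℝ), dnF b y = 0 := by
    have := (dnF_periodic b).intervalIntegral_add_zsmul_eq ⌊T⌋ 0 (fun s t => hi s t)
    simpa [dnF_integral h0 h1] using this
  rw [← intervalIntegral.integral_add_adjacent_intervals (hi 0 ⌊T⌋) (hi ⌊T⌋ T), e, zero_add]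
  have := intervalIntegral.norm_integral_le_of_norm_le_const (a := (⌊T⌋ : ℝ)) (b := T) (C := 1)
    (f := dnF b) (fun x _ => dnF_abs h0 h1 x)
  rw [Real.norm_eq_abs] at this
  refine this.trans ?_
  rw [one_mul, abs_of_nonneg (by linarith [Int.floor_le T])]
  linarith [Int.lt_floor_add_one T]

lemma dnF_corr {b : ℝ} (h0 : 0 ≤ b) (h1 : b ≤ 1) {P K : ℕ} (hP : 0 < P) (hK : 0 < K) (j : ℤ) :
    |∫ x in (j:ℝ)..(j + 1), dnF b (P * x) * dnF b ((P * K : ℕ) * x)| ≤ 1 / K := by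
  have hP' : (P : ℝ) ≠ 0 := by positivity
  have hK' : (K : ℝ) ≠ 0 := by positivity
  set g : ℝ → ℝ := fun y => dnF b y * dnF b (K * y) with hg
  have hKm : Measurable fun y : ℝ => dnF b (K * y) :=
    (dnF_meas b).comp (measurable_const.mul measurable_id)
  have hgm : Measurable g := (dnF_meas b).mul hKm
  have hgb : ∀ y, |g y| ≤ 1 := fun y => by
    rw [hg]; simp only [abs_mul]
    exact mul_le_one₀ (dnF_abs h0 h1 y) (abs_nonneg _) (dnF_abs h0 h1 _)
  have hgp : Function.Periodic g 1 := by
    intro y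
    have h2 := (dnF_periodic b).nat_mul K (K * y)
    simp only [hg, dnF_periodic b y]
    rw [mul_add, h2]
  have e1 : ∫ x in (j:ℝ)..(j + 1), dnF b (P * x) * dnF b ((P * K : ℕ) * x)
      = ∫ x in (j:ℝ)..(j + 1), g (P * x) := by
    refine intervalIntegral.integral_congr fun x _ => ?_
    simp only [hg]; push_cast; congr 2; ring
  have e2 : ∫ x in (j:ℝ)..(j + 1), g (P * x) = ∫ y in (0:ℝ)..1, g y := by
    rw [intervalIntegral.integral_comp_mul_left g hP']
    have h3 := hgp.intervalIntegral_add_zsmul_eq (P : ℤ) (P * j : ℝ)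
      (fun s t => bdd_ii hgm hgb s t)
    have h4 := hgp.intervalIntegral_add_eq (P * j : ℝ) 0
    rw [h4] at h3
    simp only [zsmul_eq_mul, Int.cast_natCast, mul_one, zero_add] at h3
    rw [mul_add, mul_one, h3, smul_eq_mul, ← mul_assoc, inv_mul_cancel₀ hP', one_mul]
  have e3 : ∫ y in (0:ℝ)..1, dnF b (K * y) = 0 := by
    rw [intervalIntegral.integral_comp_mul_left (dnF b) hK']
    have h3 := (dnF_periodic b).intervalIntegral_add_zsmul_eq (K : ℤ) 0
      (fun s t => bdd_ii (dnF_meas b) (dnF_abs h0 h1) s t)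
    simp only [zsmul_eq_mul, Int.cast_natCast, mul_one, zero_add, dnF_integral h0 h1] at h3
    simp [h3]
  rw [e1, e2, hg, dnF_mul_integral h0 h1 hKm (C := 1) (fun y => dnF_abs h0 h1 _), e3,
    intervalIntegral.integral_comp_mul_left (dnF b) hK', mul_zero (K : ℝ), mul_zero b, sub_zero, smul_eq_mul, abs_mul,
    abs_of_nonneg (by positivity), one_div]
  exact mul_le_of_le_one_right (by positivity) (dnF_prim h0 h1 _)

/-- natural number version of the product -/
def dnP (q : ℕ → ℕ) (n : ℕ) : ℕ := ∏ i ∈ Finset.range n, q i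

lemma dnP_pos {q : ℕ → ℕ} (hq : ∀ n, 2 ≤ q n) (n : ℕ) : 0 < dnP q n :=
  Finset.prod_pos fun i _ => by have := hq i; omega

lemma dnP_corr {q : ℕ → ℕ} (hq : ∀ n, 2 ≤ q n) {b : ℝ} (h0 : 0 ≤ b) (h1 : b ≤ 1) (j : ℤ)
    (m k : ℕ) :
    |∫ x in (j:ℝ)..(j + 1), dnF b (dnP q m * x) * dnF b (dnP q (m + k) * x)| ≤ (1 / 2) ^ k := by
  have hK : 2 ^ k ≤ ∏ i ∈ Finset.range k, q (m + i) := by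
    calc 2 ^ k = ∏ i ∈ Finset.range k, 2 := by simp
      _ ≤ _ := Finset.prod_le_prod' fun i _ => hq _
  have hK0 : 0 < ∏ i ∈ Finset.range k, q (m + i) := lt_of_lt_of_le (by positivity) hK
  have e : dnP q (m + k) = dnP q m * ∏ i ∈ Finset.range k, q (m + i) :=
    Finset.prod_range_add _ _ _
  rw [e]
  refine (dnF_corr h0 h1 (dnP_pos hq m) hK0 j).trans ?_
  rw [one_div_pow]
  refine one_div_le_one_div_of_le (by positivity) ?_
  exact_mod_cast hK

lemma geo_le (N : ℕ) : ∑ m ∈ Finset.range N, (1 / 2 : ℝ) ^ (N - m) ≤ 1 := by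
  induction N with
  | zero => simp
  | succ N ih =>
    rw [Finset.sum_range_succ]
    have : ∑ m ∈ Finset.range N, (1 / 2 : ℝ) ^ (N + 1 - m)
        = (∑ m ∈ Finset.range N, (1 / 2 : ℝ) ^ (N - m)) * (1 / 2) := by
      rw [Finset.sum_mul]
      refine Finset.sum_congr rfl fun m hm => ?_
      rw [← pow_succ]; congr 1; have := Finset.mem_range.1 hm; omega
    rw [this]
    simp only [Nat.add_sub_cancel_left, pow_one]
    linarith

/-- centered sum -/
def dnS (q : ℕ → ℕ) (b : ℝ) (N : ℕ) (x : ℝ) : ℝ := ∑ n ∈ Finset.range N, dnF b (dnP q n * x)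

lemma dnFP_meas (q : ℕ → ℕ) (b : ℝ) (n : ℕ) : Measurable fun x : ℝ => dnF b (dnP q n * x) :=
  (dnF_meas b).comp (measurable_const.mul measurable_id)

lemma dnS_meas (q : ℕ → ℕ) (b : ℝ) (N : ℕ) : Measurable (dnS q b N) := by
  unfold dnS
  exact Finset.measurable_sum _ fun n _ => dnFP_meas q b n

lemma dnS_abs (q : ℕ → ℕ) {b : ℝ} (h0 : 0 ≤ b) (h1 : b ≤ 1) (N : ℕ) (x : ℝ) :
    |dnS q b N x| ≤ N := by
  unfold dnS
  refine (Finset.abs_sum_le_sum_abs _ _).trans ?_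
  refine (Finset.sum_le_sum fun n _ => dnF_abs h0 h1 _).trans ?_
  simp

lemma dnS_var {q : ℕ → ℕ} (hq : ∀ n, 2 ≤ q n) {b : ℝ} (h0 : 0 ≤ b) (h1 : b ≤ 1) (j : ℤ) (N : ℕ) :
    ∫ x in (j:ℝ)..(j + 1), dnS q b N x ^ 2 ≤ 3 * N := by
  induction N with
  | zero => simp [dnS]
  | succ N ih =>
    have hpi : ∀ m n, IntervalIntegrable (fun x : ℝ => dnF b (dnP q m * x) * dnF b (dnP q n * x))
        volume j (j + 1) := fun m n =>
      bdd_ii (C := 1) ((dnFP_meas q b m).mul (dnFP_meas q b n)) (fun y => by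
        rw [Pi.mul_apply, abs_mul]
        exact mul_le_one₀ (dnF_abs h0 h1 _) (abs_nonneg _) (dnF_abs h0 h1 _)) _ _
    have hsi : IntervalIntegrable (fun x : ℝ => dnS q b N x ^ 2) volume j (j + 1) :=
      bdd_ii (C := (N:ℝ) ^ 2) ((dnS_meas q b N).pow_const 2) (fun y => by
        rw [abs_pow]
        exact pow_le_pow_left₀ (abs_nonneg _) (dnS_abs q h0 h1 N y) 2) _ _
    have e : ∀ x, dnS q b (N + 1) x ^ 2 = dnS q b N x ^ 2
        + (2 * (∑ m ∈ Finset.range N, dnF b (dnP q m * x) * dnF b (dnP q N * x))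
          + dnF b (dnP q N * x) * dnF b (dnP q N * x)) := by
      intro x
      rw [← Finset.sum_mul]
      simp only [dnS, Finset.sum_range_succ]; ring
    have hsum : IntervalIntegrable (fun x : ℝ => ∑ m ∈ Finset.range N,
        dnF b (dnP q m * x) * dnF b (dnP q N * x)) volume j (j + 1) := by
      refine bdd_ii (C := N) (Finset.measurable_sum _ fun m _ =>
        (dnFP_meas q b m).mul (dnFP_meas q b N)) (fun y => ?_) _ _
      refine (Finset.abs_sum_le_sum_abs _ _).trans ?_
      refine (Finset.sum_le_sum (g := fun _ => (1:ℝ)) fun n _ => ?_).trans (by simp)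
      rw [Pi.mul_apply, abs_mul]
      exact mul_le_one₀ (dnF_abs h0 h1 _) (abs_nonneg _) (dnF_abs h0 h1 _)
    simp only [e]
    rw [intervalIntegral.integral_add hsi ((hsum.const_mul 2).add (hpi N N)),
      intervalIntegral.integral_add (hsum.const_mul 2) (hpi N N),
      intervalIntegral.integral_const_mul,
      intervalIntegral.integral_finsetSum (fun m _ => hpi m N)]
    have hd := (le_abs_self _).trans (dnP_corr hq h0 h1 j N 0)
    have ho : ∑ m ∈ Finset.range N,
        ∫ x in (j:ℝ)..(j + 1), dnF b (dnP q m * x) * dnF b (dnP q N * x) ≤ 1 := by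
      refine (Finset.sum_le_sum fun m hm => ?_).trans (geo_le N)
      have := (le_abs_self _).trans (dnP_corr hq h0 h1 j m (N - m))
      rwa [Nat.add_sub_cancel' (Finset.mem_range.1 hm).le] at this
    simp only [add_zero, pow_zero] at hd
    push_cast
    linarith

lemma dnS_ae_interval {q : ℕ → ℕ} (hq : ∀ n, 2 ≤ q n) {b : ℝ} (h0 : 0 ≤ b) (h1 : b ≤ 1) (j : ℤ) :
    ∀ᵐ x ∂(volume.restrict (Set.Ioc (j:ℝ) (j + 1))),
      Tendsto (fun k : ℕ => dnS q b (k ^ 2) x / (k ^ 2 : ℕ)) atTop (nhds 0) := by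
  set μ := volume.restrict (Set.Ioc (j:ℝ) (j + 1))
  set G : ℕ → ℝ → ℝ := fun k x => (dnS q b (k ^ 2) x / (k ^ 2 : ℕ)) ^ 2 with hG
  have hGm : ∀ k, Measurable (G k) := fun k => ((dnS_meas q b _).div_const _).pow_const 2
  have hb : ∀ k, ∫⁻ x, ENNReal.ofReal (G k x) ∂μ ≤ ENNReal.ofReal (3 * (1 / (k:ℝ) ^ 2)) := by
    intro k
    have hint : Integrable (G k) μ := by
      have : IntervalIntegrable (G k) volume j (j + 1) := by
        refine bdd_ii (C := 1) (hGm k) (fun y => ?_) _ _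
        rw [hG]; simp only [abs_pow, abs_div, Nat.abs_cast]
        exact pow_le_one₀ (by positivity)
          (div_le_one_of_le₀ (dnS_abs q h0 h1 _ y) (by positivity))
      exact (intervalIntegrable_iff_integrableOn_Ioc_of_le (by linarith)).1 this
    rw [← ofReal_integral_eq_lintegral_ofReal hint (ae_of_all _ fun x => sq_nonneg _)]
    refine ENNReal.ofReal_le_ofReal ?_
    have hv := dnS_var hq h0 h1 j (k ^ 2)
    rw [intervalIntegral.integral_of_le (by linarith)] at hv
    simp only [hG, div_pow]
    rw [integral_div]
    rcases Nat.eq_zero_or_pos k with rfl | hk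
    · simp
    · have hk' : (0:ℝ) < k := by exact_mod_cast hk
      refine (div_le_div_of_nonneg_right hv (by positivity)).trans (le_of_eq ?_)
      push_cast
      field_simp
  have hfin : ∫⁻ x, ∑' k, ENNReal.ofReal (G k x) ∂μ ≠ ⊤ := by
    rw [lintegral_tsum fun k => (hGm k).ennreal_ofReal.aemeasurable]
    refine ne_top_of_le_ne_top ?_ (ENNReal.tsum_le_tsum hb)
    have hs : Summable fun k : ℕ => 3 * (1 / (k:ℝ) ^ 2) :=
      (Real.summable_one_div_nat_pow.2 (by norm_num)).mul_left 3
    exact hs.tsum_ofReal_ne_top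
  have hae := ae_lt_top (Measurable.tsum fun k => (hGm k).ennreal_ofReal) hfin
  filter_upwards [hae] with x hx
  have ht := ENNReal.tendsto_atTop_zero_of_tsum_ne_top hx.ne
  have ht2 : Tendsto (fun k => G k x) atTop (nhds 0) := by
    have := (ENNReal.tendsto_toReal ENNReal.zero_ne_top).comp ht
    refine this.congr fun k => ?_
    simp only [Function.comp]
    exact ENNReal.toReal_ofReal (sq_nonneg _)
  have ht3 := (Real.continuous_sqrt.tendsto 0).comp ht2
  rw [Real.sqrt_zero] at ht3
  rw [tendsto_zero_iff_abs_tendsto_zero]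
  refine ht3.congr fun k => ?_
  simp only [Function.comp, hG, Real.sqrt_sq_eq_abs]

lemma dnS_ae {q : ℕ → ℕ} (hq : ∀ n, 2 ≤ q n) {b : ℝ} (h0 : 0 ≤ b) (h1 : b ≤ 1) :
    ∀ᵐ x : ℝ, Tendsto (fun k : ℕ => dnS q b (k ^ 2) x / (k ^ 2 : ℕ)) atTop (nhds 0) := by
  have h := (ae_restrict_iUnion_iff (μ := (volume : Measure ℝ))
    (fun j : ℤ => Set.Ioc (j:ℝ) (j + 1)) _).2 (fun j => dnS_ae_interval hq h0 h1 j)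
  have hu : (⋃ j : ℤ, Set.Ioc (j:ℝ) (j + 1)) = Set.univ := iUnion_Ioc_intCast ℝ
  rwa [hu, Measure.restrict_univ] at h

/-- counting function -/
def dnC (q : ℕ → ℕ) (b : ℝ) (x : ℝ) (N : ℕ) : ℝ :=
  ((Finset.range N).filter (fun n => Int.fract (cantorProd q n * x) < b)).card

lemma dnC_eq (q : ℕ → ℕ) (b x : ℝ) (N : ℕ) : dnC q b x N = dnS q b N x + N * b := by
  have : ∀ n, cantorProd q n = dnP q n := fun n => by simp [cantorProd, dnP]
  simp [dnC, dnS, dnF, this]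

lemma dnC_mono (q : ℕ → ℕ) (b x : ℝ) : Monotone (dnC q b x) := by
  intro M N h
  unfold dnC
  exact_mod_cast Finset.card_le_card (Finset.filter_subset_filter _ (Finset.range_mono h))

lemma dnC_mono_b (q : ℕ → ℕ) {b c : ℝ} (h : b ≤ c) (x : ℝ) (N : ℕ) :
    dnC q b x N ≤ dnC q c x N := by
  unfold dnC
  exact_mod_cast Finset.card_le_card
    (Finset.monotone_filter_right _ (fun n _ hn => lt_of_lt_of_le hn h))

lemma dnC_tendsto {q : ℕ → ℕ} {b x : ℝ}
    (h : Tendsto (fun k : ℕ => dnS q b (k ^ 2) x / (k ^ 2 : ℕ)) atTop (nhds 0)) :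
    Tendsto (fun N => dnC q b x N / N) atTop (nhds b) := by
  refine tendsto_div_of_monotone_of_exists_subseq_tendsto_div _ _ (dnC_mono q b x) ?_
  intro a ha
  refine ⟨fun k => k ^ 2, ?_, tendsto_pow_atTop (by norm_num), ?_⟩
  · have h1 : Tendsto (fun k : ℕ => (1 + 1 / (k:ℝ)) ^ 2) atTop (nhds 1) := by
      have := (tendsto_const_nhds (x := (1:ℝ))).add (tendsto_one_div_atTop_nhds_zero_nat (𝕜 := ℝ))
      simpa using this.pow 2
    filter_upwards [h1.eventually_lt_const ha, eventually_gt_atTop 0] with k hk hk0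
    have hk' : (0:ℝ) < k := by exact_mod_cast hk0
    have : ((k:ℝ) + 1) ^ 2 = (1 + 1 / (k:ℝ)) ^ 2 * k ^ 2 := by field_simp
    push_cast
    rw [this]
    gcongr
  · have := h.add_const b
    rw [zero_add] at this
    refine this.congr' ?_
    filter_upwards [eventually_gt_atTop 0] with k hk
    have hk' : (0:ℝ) < k := by exact_mod_cast hk
    rw [dnC_eq]; push_cast; field_simp

lemma dnC_tendsto_real {q : ℕ → ℕ} {x : ℝ}
    (h : ∀ r : ℚ, 0 ≤ (r:ℝ) → (r:ℝ) ≤ 1 → Tendsto (fun N => dnC q r x N / N) atTop (nhds (r:ℝ)))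
    {b : ℝ} (h0 : 0 ≤ b) (h1 : b ≤ 1) :
    Tendsto (fun N => dnC q b x N / N) atTop (nhds b) := by
  rw [tendsto_order]
  constructor
  · intro c hc
    by_cases hc0 : c < 0
    · refine Filter.Eventually.of_forall fun N => lt_of_lt_of_le hc0 ?_
      unfold dnC; positivity
    · obtain ⟨r, hr1, hr2⟩ := exists_rat_btwn hc
      push Not at hc0
      filter_upwards [(h r (by linarith) (by linarith)).eventually_const_lt hr1] with N hN
      exact hN.trans_le (div_le_div_of_nonneg_right (dnC_mono_b q hr2.le x N) (by positivity))
  · intro c hc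
    by_cases hc1 : 1 < c
    · refine Filter.Eventually.of_forall fun N => lt_of_le_of_lt ?_ hc1
      refine div_le_one_of_le₀ ?_ (by positivity)
      unfold dnC
      exact_mod_cast (Finset.card_filter_le _ _).trans (by simp)
    · obtain ⟨r, hr1, hr2⟩ := exists_rat_btwn hc
      push Not at hc1
      filter_upwards [(h r (by linarith) (by linarith)).eventually_lt_const hr2] with N hN
      exact (div_le_div_of_nonneg_right (dnC_mono_b q hr1.le x N) (by positivity)).trans_lt hN

/-- For every basic sequence `Q`, almost every real number is
`Q`-distribution normal. -/
theorem distNormal_ae (q : ℕ → ℕ) (hq : ∀ n, 2 ≤ q n) :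
    ∀ᵐ x : ℝ, QDistNormal q x := by
  have h : ∀ᵐ x : ℝ, ∀ r : ℚ, 0 ≤ (r:ℝ) → (r:ℝ) ≤ 1 →
      Tendsto (fun N => dnC q r x N / N) atTop (nhds (r:ℝ)) := by
    rw [ae_all_iff]
    intro r
    by_cases hr : 0 ≤ (r:ℝ) ∧ (r:ℝ) ≤ 1
    · filter_upwards [dnS_ae hq hr.1 hr.2] with x hx _ _
      exact dnC_tendsto hx
    · exact ae_of_all _ fun x a b => absurd ⟨a, b⟩ hr
  filter_upwards [h] with x hx a b ha hab hb
  have := (dnC_tendsto_real hx (ha.trans hab) hb).sub (dnC_tendsto_real hx ha (hab.trans hb))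
  refine this.congr fun N => ?_
  rw [← sub_div]
  congr 1
  rw [sub_eq_iff_eq_add]
  unfold dnC
  norm_cast
  rw [← Finset.card_union_of_disjoint]
  · congr 1
    ext n
    simp only [Finset.mem_filter, Finset.mem_union, Set.mem_Ico]
    constructor
    · rintro ⟨h1, h2⟩
      by_cases h3 : Int.fract (cantorProd q n * x) < a
      · exact Or.inr ⟨h1, h3⟩
      · exact Or.inl ⟨h1, not_lt.1 h3, h2⟩
    · rintro (⟨h1, h2, h3⟩ | ⟨h1, h2⟩)
      · exact ⟨h1, h3⟩
      · exact ⟨h1, h2.trans_le hab⟩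
  · rw [Finset.disjoint_left]
    intro n h1 h2
    simp only [Finset.mem_filter, Set.mem_Ico] at h1 h2
    linarith [h1.2.1, h2.2]
end
end

section
/- Suppose $Q = (q_n)$ is a basic sequence with $q_n \to \infty$ and $\lim_{n\to\infty} (\log q_n)/(\sum_{i=1}^n \log q_i) = 0$. Let $S \subseteq \mathbb{N}$ satisfy $\min S < \min_n q_n$ and suppose the mass dimension $\dim_M(S)$ exists. Then the Hausdorff dimension of $\mathscr{W}_Q(S) = \{x \in \mathbb{R} : \mathscr{S}_Q(x) = S\}$ equals $\dim_M(S)$. -/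
open scoped Classical
open Filter MeasureTheory

noncomputable section

/-- The set of reals whose set of `Q`-Cantor digits is exactly `S`. -/
def digitRangeSet (q : ℕ → ℕ) (S : Set ℕ) : Set ℝ :=
  {x : ℝ | ∃ E : ℕ → ℕ, IsCantorExp q x E ∧ {d : ℕ | ∃ n, E n = d} = S}

/-- Integer part of `P_n x` for the digit sequence `E`. -/
def intPart (q E : ℕ → ℕ) : ℕ → ℕ
  | 0 => 0
  | n + 1 => q n * intPart q E n + E n

lemma cantorProd_succ (q : ℕ → ℕ) (n : ℕ) : cantorProd q (n + 1) = cantorProd q n * q n :=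
  Finset.prod_range_succ _ _

lemma cantorProd_zero (q : ℕ → ℕ) : cantorProd q 0 = 1 := by simp [cantorProd]

lemma cantorProd_pos {q : ℕ → ℕ} (hq : ∀ n, 2 ≤ q n) (n : ℕ) : 0 < cantorProd q n :=
  Finset.prod_pos fun i _ => by have := hq i; positivity

lemma two_pow_le_cantorProd {q : ℕ → ℕ} (hq : ∀ n, 2 ≤ q n) (n : ℕ) :
    (2 : ℝ) ^ n ≤ cantorProd q n := by
  induction n with
  | zero => simp [cantorProd]
  | succ n ih =>
    rw [cantorProd_succ, pow_succ]
    have : (2 : ℝ) ≤ q n := by exact_mod_cast hq n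
    have := (cantorProd_pos hq n).le
    gcongr

lemma cantor_partial_sum {q : ℕ → ℕ} (hq : ∀ n, 2 ≤ q n) (E : ℕ → ℕ) (n : ℕ) :
    ∑ i ∈ Finset.range n, (E i : ℝ) / cantorProd q (i + 1) = intPart q E n / cantorProd q n := by
  induction n with
  | zero => simp [intPart]
  | succ n ih =>
    rw [Finset.sum_range_succ, ih, cantorProd_succ, intPart]
    have h1 := (cantorProd_pos hq n).ne'
    have h2 : (q n : ℝ) ≠ 0 := by have := hq n; positivity
    push_cast
    field_simp

lemma intPart_upper_anti {q : ℕ → ℕ} (hq : ∀ n, 2 ≤ q n) {E : ℕ → ℕ} (hE : ∀ n, E n < q n) :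
    Antitone fun n => ((intPart q E n : ℝ) + 1) / cantorProd q n := by
  refine antitone_nat_of_succ_le fun n => ?_
  rw [cantorProd_succ, intPart]
  have h1 := cantorProd_pos hq n
  have h2 : (0 : ℝ) < q n := by have := hq n; positivity
  have h3 : (E n : ℝ) + 1 ≤ q n := by exact_mod_cast hE n
  rw [div_le_div_iff₀ (by positivity) h1]
  push_cast
  nlinarith [mul_le_mul_of_nonneg_left h3 h1.le]

lemma cantor_bounds {q : ℕ → ℕ} (hq : ∀ n, 2 ≤ q n) {E : ℕ → ℕ} (hE : ∀ n, E n < q n) (n : ℕ) :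
    (intPart q E n : ℝ) / cantorProd q n ≤ ∑' n, (E n : ℝ) / cantorProd q (n + 1) ∧
    ∑' n, (E n : ℝ) / cantorProd q (n + 1) ≤ ((intPart q E n : ℝ) + 1) / cantorProd q n := by
  have hpos : ∀ n, 0 ≤ (E n : ℝ) / cantorProd q (n + 1) := fun n =>
    div_nonneg (by positivity) (cantorProd_pos hq _).le
  have hub : ∀ m n, m ≤ n → (intPart q E n : ℝ) / cantorProd q n
      ≤ ((intPart q E m : ℝ) + 1) / cantorProd q m := by
    intro m n h
    refine le_trans ?_ (intPart_upper_anti hq hE h)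
    have := cantorProd_pos hq n
    dsimp only
    gcongr
    linarith
  have hsum : Summable fun n => (E n : ℝ) / cantorProd q (n + 1) := by
    refine summable_of_sum_range_le (c := ((intPart q E 0 : ℝ) + 1) / cantorProd q 0) hpos ?_
    intro n
    rw [cantor_partial_sum hq]
    exact hub _ _ (Nat.zero_le _)
  constructor
  · rw [← cantor_partial_sum hq]
    exact hsum.sum_le_tsum _ fun i _ => hpos i
  · refine le_of_tendsto hsum.hasSum.tendsto_sum_nat ?_
    filter_upwards [eventually_ge_atTop n] with m hm
    rw [cantor_partial_sum hq]
    exact hub _ _ hm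

lemma cantor_lt_one {q : ℕ → ℕ} (hq : ∀ n, 2 ≤ q n) {E : ℕ → ℕ} (hE : ∀ n, E n < q n)
    {n : ℕ} (hn : E n + 1 < q n) : ∑' n, (E n : ℝ) / cantorProd q (n + 1) < 1 := by
  refine lt_of_le_of_lt (cantor_bounds hq hE (n + 1)).2 ?_
  have h1 := intPart_upper_anti hq hE (Nat.zero_le n)
  simp only [cantorProd_zero, intPart, Nat.cast_zero, zero_add, div_one] at h1
  have hp := cantorProd_pos hq n
  rw [div_le_one hp] at h1
  rw [div_lt_one (cantorProd_pos hq _), cantorProd_succ, intPart]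
  have h3 : (E n : ℝ) + 1 < q n := by exact_mod_cast hn
  have h2 : (0 : ℝ) < q n := by have := hq n; positivity
  push_cast
  nlinarith [mul_le_mul_of_nonneg_left h1 h2.le]

lemma count_sub_le (p : ℕ → Prop) [DecidablePred p] {a b : ℕ} (h : a ≤ b) :
    Nat.count p b + a ≤ Nat.count p a + b := by
  obtain ⟨c, rfl⟩ := Nat.exists_eq_add_of_le h
  rw [Nat.count_add]
  have := Nat.count_le (fun k => p (a + k)) (n := c)
  omega

lemma rank_compare {q N : ℕ → ℕ} {T : ℕ → Finset ℕ}
    (hN : ∀ n, N n = Nat.count (· ∈ T n) (q n))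
    {E E' J J' : ℕ → ℕ} (hEq : ∀ n, E n < q n) (hEq' : ∀ n, E' n < q n)
    (hET : ∀ n, E n ∈ T n) (hET' : ∀ n, E' n ∈ T n)
    (hJ : ∀ n, J n = Nat.count (· ∈ T n) (E n)) (hJ' : ∀ n, J' n = Nat.count (· ∈ T n) (E' n))
    (n : ℕ) : intPart q E n ≤ intPart q E' n →
      (intPart N J n ≤ intPart N J' n ∧
      intPart N J' n + intPart q E n ≤ intPart N J n + intPart q E' n ∧
      (intPart q E n < intPart q E' n → intPart N J n < intPart N J' n)) := by
  induction n with
  | zero => simp [intPart]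
  | succ n ih =>
    simp only [intPart]
    intro h
    have hle : intPart q E n ≤ intPart q E' n := by
      by_contra hc
      have : intPart q E' n + 1 ≤ intPart q E n := by omega
      have := Nat.mul_le_mul_left (q n) this
      have := hEq' n
      rw [mul_add] at *
      omega
    obtain ⟨h1, h2, h3⟩ := ih hle
    generalize intPart q E n = X at *
    generalize intPart q E' n = X' at *
    generalize intPart N J n = Y at *
    generalize intPart N J' n = Y' at *
    have hJN : J n < N n := by rw [hJ, hN]; exact Nat.count_strict_mono (hET n) (hEq n)
    have hJN' : J' n < N n := by rw [hJ', hN]; exact Nat.count_strict_mono (hET' n) (hEq' n)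
    have hNq : N n ≤ q n := by rw [hN]; exact Nat.count_le _
    have hc : N n + E n ≤ J n + q n := by
      rw [hN, hJ]; exact count_sub_le _ (hEq n).le
    have hJE' : J' n ≤ E' n := by rw [hJ']; exact Nat.count_le _
    rcases hle.eq_or_lt with rfl | hlt
    · have hY : Y = Y' := by omega
      subst hY
      have hEE : E n ≤ E' n := by omega
      have a1 : J n ≤ J' n := by rw [hJ, hJ']; exact Nat.count_monotone _ hEE
      have a2 : J' n + E n ≤ J n + E' n := by rw [hJ, hJ']; exact count_sub_le _ hEE
      refine ⟨by omega, by omega, fun h => ?_⟩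
      have : J n < J' n := by rw [hJ, hJ']; exact Nat.count_strict_mono (hET n) (by omega)
      omega
    · have hYlt := h3 hlt
      obtain ⟨l, rfl⟩ := Nat.exists_eq_add_of_lt hYlt
      have hX' : X + l + 1 ≤ X' := by omega
      obtain ⟨k, rfl⟩ := Nat.exists_eq_add_of_le hX'
      have e1 : N n * (Y + l + 1) = N n * Y + N n * l + N n := by ring
      have e2 : q n * (X + l + 1 + k) = q n * X + q n * l + q n + q n * k := by ring
      have e3 : N n * l ≤ q n * l := Nat.mul_le_mul_right _ hNq
      rw [e1, e2]
      refine ⟨by omega, by omega, fun _ => by omega⟩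

lemma lower_generic {q : ℕ → ℕ} (hq : ∀ n, 2 ≤ q n) {T : ℕ → Finset ℕ}
    (hT : ∀ n, ∀ e ∈ T n, e < q n) (hne : ∀ n, (T n).Nonempty)
    (hinf : ∀ m, ∃ n, m ≤ n ∧ ∀ e ∈ T n, e + 1 < q n)
    {s C : ℝ} (hs : 0 < s) (hC0 : 0 < C)
    (hC : ∀ n, cantorProd q (n + 1) ^ s ≤ C * cantorProd (fun i => (T i).card) n) :
    ENNReal.ofReal s ≤ dimH {x : ℝ | ∃ E, IsCantorExp q x E ∧ ∀ n, E n ∈ T n} := by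
  set N : ℕ → ℕ := fun i => (T i).card with hNdef
  have hNpos : ∀ n, 0 < N n := fun n => (hne n).card_pos
  have hNc : ∀ n, N n = Nat.count (· ∈ T n) (q n) := by
    intro n
    rw [Nat.count_eq_card_filter_range]
    simp only [hNdef]
    congr 1
    ext e
    simp only [Finset.mem_filter, Finset.mem_range]
    exact ⟨fun h => ⟨hT n e h, h⟩, fun h => h.2⟩
  have hMpos : ∀ n, 0 < cantorProd N n := fun n =>
    Finset.prod_pos fun i _ => by have := hNpos i; positivity
  -- digits
  let Y : ℝ → ℕ → ℕ := fun y n => ⌊y * cantorProd N n⌋₊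
  let J : ℝ → ℕ → ℕ := fun y n => Y y (n + 1) % N n
  have hY : ∀ y ∈ Set.Ico (0 : ℝ) 1, ∀ n, intPart N (J y) n = Y y n := by
    intro y hy n
    induction n with
    | zero =>
      simp only [intPart, Y, cantorProd_zero, mul_one]
      exact (Nat.floor_eq_zero.2 hy.2).symm
    | succ n ih =>
      rw [intPart, ih]
      have : Y y n = Y y (n + 1) / N n := by
        simp only [Y]
        rw [← Nat.floor_div_natCast, cantorProd_succ]
        congr 1
        have : (N n : ℝ) ≠ 0 := by have := hNpos n; positivity
        field_simp
      rw [this]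
      exact Nat.div_add_mod _ _
  let E : ℝ → ℕ → ℕ := fun y n => Nat.nth (· ∈ T n) (J y n)
  have hnth : ∀ y n, ∀ hf : (Set.ofPred (· ∈ T n)).Finite, J y n < hf.toFinset.card := by
    intro y n hf
    have : hf.toFinset = T n := by ext; simp
    rw [this]
    exact Nat.mod_lt _ (hNpos n)
  have hET : ∀ y n, E y n ∈ T n := fun y n => Nat.nth_mem (p := (· ∈ T n)) _ (hnth y n)
  have hEq : ∀ y n, E y n < q n := fun y n => hT n _ (hET y n)
  have hJ : ∀ y n, J y n = Nat.count (· ∈ T n) (E y n) := fun y n =>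
    (Nat.count_nth (p := (· ∈ T n)) (hnth y n)).symm
  let G : ℝ → ℝ := fun y => ∑' n, (E y n : ℝ) / cantorProd q (n + 1)
  have hG0 : ∀ y, 0 ≤ G y := fun y => by
    have := (cantor_bounds hq (hEq y) 0).1
    simpa [intPart] using this
  have hG1 : ∀ y, G y < 1 := fun y => by
    obtain ⟨n, -, hn⟩ := hinf 0
    exact cantor_lt_one hq (hEq y) (hn _ (hET y n))
  -- key estimate
  have key0 : ∀ y ∈ Set.Ico (0 : ℝ) 1, ∀ y' ∈ Set.Ico (0 : ℝ) 1, ∀ n,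
      intPart q (E y) n ≤ intPart q (E y') n →
      |y - y'| * cantorProd N n ≤ |G y - G y'| * cantorProd q n + 2 := by
    intro y hy y' hy' n hle
    obtain ⟨h1, h2, -⟩ := rank_compare hNc (hEq y) (hEq y') (hET y) (hET y') (hJ y) (hJ y') n hle
    rw [hY y hy, hY y' hy'] at h1 h2
    have h1' : (Y y n : ℝ) ≤ Y y' n := by exact_mod_cast h1
    have h2' : (Y y' n : ℝ) + intPart q (E y) n ≤ Y y n + intPart q (E y') n := by
      exact_mod_cast h2
    have hP := cantorProd_pos hq n
    have hM := hMpos n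
    have b1 := (cantor_bounds hq (hEq y) n).2
    have b2 := (cantor_bounds hq (hEq y') n).1
    rw [le_div_iff₀ hP] at b1
    rw [div_le_iff₀ hP] at b2
    have f1 : (Y y n : ℝ) ≤ y * cantorProd N n := Nat.floor_le (mul_nonneg hy.1 hM.le)
    have f2 : y * cantorProd N n < Y y n + 1 := Nat.lt_floor_add_one _
    have f3 : (Y y' n : ℝ) ≤ y' * cantorProd N n := Nat.floor_le (mul_nonneg hy'.1 hM.le)
    have f4 : y' * cantorProd N n < Y y' n + 1 := Nat.lt_floor_add_one _
    have g1 : (G y' - G y) * cantorProd q n ≤ |G y - G y'| * cantorProd q n := by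
      gcongr
      rw [abs_sub_comm]
      exact le_abs_self _
    have g2 : |y - y'| * cantorProd N n = |y * cantorProd N n - y' * cantorProd N n| := by
      rw [← sub_mul, abs_mul, abs_of_pos hM]
    have b1' : G y * cantorProd q n ≤ intPart q (E y) n + 1 := b1
    have b2' : (intPart q (E y') n : ℝ) ≤ G y' * cantorProd q n := b2
    have g0 : 0 ≤ |G y - G y'| * cantorProd q n := by positivity
    rw [sub_mul] at g1
    rw [g2, abs_le]
    constructor <;> linarith
  have key1 : ∀ y ∈ Set.Ico (0 : ℝ) 1, ∀ y' ∈ Set.Ico (0 : ℝ) 1, ∀ n,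
      |y - y'| * cantorProd N n ≤ |G y - G y'| * cantorProd q n + 2 := by
    intro y hy y' hy' n
    rcases le_total (intPart q (E y) n) (intPart q (E y') n) with h | h
    · exact key0 y hy y' hy' n h
    · rw [abs_sub_comm y, abs_sub_comm (G y)]
      exact key0 y' hy' y hy n h
  have key : ∀ y ∈ Set.Ico (0 : ℝ) 1, ∀ y' ∈ Set.Ico (0 : ℝ) 1,
      |y - y'| ≤ 3 * C * |G y - G y'| ^ s := by
    intro y hy y' hy'
    set δ := |G y - G y'| with hδ
    have hδ0 : 0 ≤ δ := abs_nonneg _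
    have hδ1 : δ ≤ 1 := by
      rw [hδ, abs_le]
      constructor <;> linarith [hG0 y, hG0 y', hG1 y, hG1 y']
    have bd : ∀ n, δ * cantorProd q n ≤ 1 → |y - y'| * cantorProd q (n + 1) ^ s ≤ 3 * C := by
      intro n hn
      have h1 := key1 y hy y' hy' n
      calc |y - y'| * cantorProd q (n + 1) ^ s ≤ |y - y'| * (C * cantorProd N n) := by
            gcongr; exact hC n
        _ = C * (|y - y'| * cantorProd N n) := by ring
        _ ≤ C * 3 := by gcongr; linarith
        _ = 3 * C := by ring
    have hPtop : Tendsto (fun n => cantorProd q n) atTop atTop :=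
      tendsto_atTop_mono (two_pow_le_cantorProd hq) (tendsto_pow_atTop_atTop_of_one_lt (by norm_num))
    rcases hδ0.eq_or_lt with h0 | hpos
    · rw [← h0, Real.zero_rpow hs.ne', mul_zero]
      by_contra hc
      push Not at hc
      have ht : Tendsto (fun n => |y - y'| * cantorProd q (n + 1) ^ s) atTop atTop :=
        Tendsto.const_mul_atTop hc
          ((tendsto_rpow_atTop hs).comp (hPtop.comp (tendsto_add_atTop_nat 1)))
      obtain ⟨n, hn⟩ := (ht.eventually_gt_atTop (3 * C)).exists
      exact absurd (bd n (by rw [← h0]; simp)) (not_le.2 hn)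
    · have hex : ∃ n, 1 < δ * cantorProd q n :=
        ((hPtop.const_mul_atTop hpos).eventually_gt_atTop 1).exists
      have hsp := Nat.find_spec hex
      have hmi := fun m => Nat.find_min hex (m := m)
      cases hn : Nat.find hex with
      | zero => rw [hn, cantorProd_zero] at hsp; linarith
      | succ m =>
        rw [hn] at hsp hmi
        have h1 := bd m (not_lt.1 (hmi m (Nat.lt_succ_self m)))
        have hP := cantorProd_pos hq (m + 1)
        have h2 : 1 ≤ δ ^ s * cantorProd q (m + 1) ^ s := by
          rw [← Real.mul_rpow hδ0 hP.le]
          exact Real.one_le_rpow hsp.le hs.le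
        calc |y - y'| ≤ |y - y'| * (δ ^ s * cantorProd q (m + 1) ^ s) :=
              le_mul_of_one_le_right (abs_nonneg _) h2
          _ = (|y - y'| * cantorProd q (m + 1) ^ s) * δ ^ s := by ring
          _ ≤ 3 * C * δ ^ s := by gcongr
  have hinj : Set.InjOn G (Set.Ico (0 : ℝ) 1) := by
    intro y hy y' hy' h
    have := key y hy y' hy'
    rw [h, sub_self, abs_zero, Real.zero_rpow hs.ne', mul_zero] at this
    exact sub_eq_zero.1 (abs_eq_zero.1 (le_antisymm this (abs_nonneg _)))
  have hleft := hinj.leftInvOn_invFunOn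
  have hsub : G '' Set.Ico (0 : ℝ) 1 ⊆ {x : ℝ | ∃ E, IsCantorExp q x E ∧ ∀ n, E n ∈ T n} := by
    rintro _ ⟨y, hy, rfl⟩
    refine ⟨E y, ⟨hEq y, ?_, ?_⟩, hET y⟩
    · intro m
      obtain ⟨n, hn, h⟩ := hinf m
      have := h _ (hET y n)
      exact ⟨n, hn, by omega⟩
    · have : ⌊G y⌋ = 0 := Int.floor_eq_zero_iff.2 ⟨hG0 y, hG1 y⟩
      rw [this]
      simp [G]
  refine le_trans ?_ (dimH_mono hsub)
  have hhol : HolderOnWith (Real.toNNReal (3 * C)) (Real.toNNReal s)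
      (Function.invFunOn G (Set.Ico (0 : ℝ) 1)) (G '' Set.Ico (0 : ℝ) 1) := by
    rintro _ ⟨y, hy, rfl⟩ _ ⟨y', hy', rfl⟩
    rw [hleft hy, hleft hy', edist_dist, edist_dist, Real.dist_eq, Real.dist_eq,
      Real.coe_toNNReal _ hs.le, ENNReal.ofReal_rpow_of_nonneg (abs_nonneg _) hs.le,
      ← ENNReal.ofReal.eq_1, ← ENNReal.ofReal_mul (by positivity)]
    exact ENNReal.ofReal_le_ofReal (key y hy y' hy')
  have hd := hhol.dimH_image_le (Real.toNNReal_pos.2 hs)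
  rw [hleft.image_image] at hd
  rw [Real.dimH_of_nonempty_interior (by simp), Module.finrank_self,
    ENNReal.le_div_iff_mul_le (by left; simpa using hs) (by left; simp)] at hd
  simpa [ENNReal.ofReal] using hd

lemma upper_generic {q : ℕ → ℕ} (hq : ∀ n, 2 ≤ q n) {T : ℕ → Finset ℕ}
    {s C : ℝ} (hs : 0 ≤ s)
    (hC : ∀ n, cantorProd (fun i => (T i).card) n ≤ C * cantorProd q n ^ s) :
    dimH {x : ℝ | ∃ E, IsCantorExp q x E ∧ ∀ n, E n ∈ T n} ≤ ENNReal.ofReal s := by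
  obtain ⟨K, hK0, hKs⟩ : ∃ K : ℕ → Finset ℕ, K 0 = {0} ∧ ∀ n, K (n + 1) =
      Finset.image₂ (fun X e => q n * X + e) (K n) (T n) :=
    ⟨fun n => Nat.rec {0} (fun n K => Finset.image₂ (fun X e => q n * X + e) K (T n)) n,
      rfl, fun _ => rfl⟩
  have hK : ∀ n, ((K n).card : ℝ) ≤ cantorProd (fun i => (T i).card) n := by
    intro n
    induction n with
    | zero => simp [hK0, cantorProd]
    | succ n ih =>
      rw [cantorProd_succ]
      refine le_trans ?_ (mul_le_mul_of_nonneg_right ih (by positivity))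
      rw [hKs]
      exact_mod_cast Finset.card_image₂_le _ (K n) (T n)
  have hKmem : ∀ E : ℕ → ℕ, (∀ n, E n ∈ T n) → ∀ n, intPart q E n ∈ K n := by
    intro E hE n
    induction n with
    | zero => simp [hK0, intPart]
    | succ n ih => rw [hKs]; exact Finset.mem_image₂.2 ⟨_, ih, _, hE n, rfl⟩
  have hcov : {x : ℝ | ∃ E, IsCantorExp q x E ∧ ∀ n, E n ∈ T n} ⊆
      ⋃ m : ℤ, {x : ℝ | ∃ E, IsCantorExp q x E ∧ (∀ n, E n ∈ T n) ∧ ⌊x⌋ = m} := by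
    rintro x ⟨E, h1, h2⟩
    exact Set.mem_iUnion.2 ⟨⌊x⌋, E, h1, h2, rfl⟩
  refine (dimH_mono hcov).trans ?_
  rw [dimH_iUnion]
  refine iSup_le fun m => ?_
  refine dimH_le_of_hausdorffMeasure_ne_top (d := Real.toNNReal s) ?_
  rw [Real.coe_toNNReal _ hs]
  have hP := cantorProd_pos hq
  have hr : Tendsto (fun n => ENNReal.ofReal (1 / cantorProd q n)) atTop (nhds 0) := by
    rw [← ENNReal.ofReal_zero]
    refine ENNReal.tendsto_ofReal ?_
    have hPtop : Tendsto (fun n => cantorProd q n) atTop atTop :=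
      tendsto_atTop_mono (two_pow_le_cantorProd hq) (tendsto_pow_atTop_atTop_of_one_lt (by norm_num))
    simp only [one_div]
    exact hPtop.inv_tendsto_atTop
  let t : ∀ n, K n → Set ℝ := fun n X =>
    Set.Icc (m + (X : ℕ) / cantorProd q n) (m + ((X : ℕ) + 1) / cantorProd q n)
  have hdiam : ∀ n X, Metric.ediam (t n X) = ENNReal.ofReal (1 / cantorProd q n) := by
    intro n X
    simp only [t, Real.ediam_Icc]
    congr 1
    ring
  have hmain := Measure.hausdorffMeasure_le_liminf_sum s
    {x : ℝ | ∃ E, IsCantorExp q x E ∧ (∀ n, E n ∈ T n) ∧ ⌊x⌋ = m} _ hr t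
    (Eventually.of_forall fun n X => (hdiam n X).le) (Eventually.of_forall fun n => by
      rintro x ⟨E, ⟨h1, h2, h3⟩, h4, h5⟩
      refine Set.mem_iUnion.2 ⟨⟨_, hKmem E h4 n⟩, ?_⟩
      have hb := cantor_bounds hq h1 n
      rw [h5] at h3
      rw [h3]
      exact ⟨by linarith [hb.1], by linarith [hb.2]⟩)
  refine ne_top_of_le_ne_top (ENNReal.ofReal_ne_top (r := C)) (hmain.trans ?_)
  refine liminf_le_of_le (by isBoundedDefault) ?_
  intro b hb
  obtain ⟨n, hn⟩ := hb.exists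
  refine hn.trans ?_
  simp only [hdiam, Finset.sum_const, nsmul_eq_mul, Finset.card_univ, Fintype.card_coe]
  rw [ENNReal.ofReal_rpow_of_nonneg (div_nonneg zero_le_one (hP n).le) hs,
    ← ENNReal.ofReal_natCast, ← ENNReal.ofReal_mul (by positivity)]
  refine ENNReal.ofReal_le_ofReal ?_
  rw [Real.div_rpow zero_le_one (hP n).le, Real.one_rpow, mul_one_div,
    div_le_iff₀ (Real.rpow_pos_of_pos (hP n) _)]
  exact (hK n).trans (hC n)

lemma mass_lim {S : Set ℕ} {γ : ℝ} (hmass : Tendsto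
      (fun n : ℕ => Real.log (((Finset.range n).filter
          (fun m => m ∈ S ∧ 2 * m < n)).card : ℝ) / Real.log n)
      atTop (nhds γ)) :
    Tendsto (fun k : ℕ => Real.log (((Finset.range k).filter (fun m => m ∈ S)).card : ℝ)
      / Real.log k) atTop (nhds γ) := by
  have h1 := hmass.comp (tendsto_id.const_mul_atTop' (two_pos : (0 : ℕ) < 2))
  have hlogtop : Tendsto (fun k : ℕ => Real.log k) atTop atTop :=
    Real.tendsto_log_atTop.comp tendsto_natCast_atTop_atTop
  have h2 : Tendsto (fun k : ℕ => 1 + Real.log 2 / Real.log k) atTop (nhds (1 + 0)) :=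
    tendsto_const_nhds.add (hlogtop.const_div_atTop _)
  have h3 := h1.mul h2
  rw [add_zero, mul_one] at h3
  refine h3.congr' ?_
  filter_upwards [eventually_ge_atTop 2] with k hk
  simp only [Function.comp, id]
  have hcard : ((Finset.range (2 * k)).filter (fun m => m ∈ S ∧ 2 * m < 2 * k))
      = (Finset.range k).filter (fun m => m ∈ S) := by
    ext m
    simp only [Finset.mem_filter, Finset.mem_range]
    constructor
    · rintro ⟨a, b, c⟩; exact ⟨by omega, b⟩
    · rintro ⟨a, b⟩; exact ⟨by omega, b, by omega⟩
  rw [hcard]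
  have hk' : (2 : ℝ) ≤ k := by exact_mod_cast hk
  have hl : 0 < Real.log k := Real.log_pos (by linarith)
  have hl2 : 0 < Real.log 2 := Real.log_pos (by norm_num)
  push_cast
  rw [Real.log_mul (by norm_num) (by positivity)]
  field_simp
  ring

lemma sum_bdd {u : ℕ → ℝ} (hu : ∀ᶠ i in atTop, u i ≤ 0) :
    ∃ B, ∀ n, ∑ i ∈ Finset.range n, u i ≤ B := by
  obtain ⟨n0, h0⟩ := eventually_atTop.1 hu
  have : IsBoundedUnder (· ≤ ·) atTop (fun n => ∑ i ∈ Finset.range n, u i) := by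
    refine ⟨∑ i ∈ Finset.range n0, u i, ?_⟩
    rw [eventually_map]
    filter_upwards [eventually_ge_atTop n0] with n hn
    induction n, hn using Nat.le_induction with
    | base => exact le_rfl
    | succ n hn ih =>
      rw [Finset.sum_range_succ]
      linarith [h0 n hn]
  obtain ⟨B, hB⟩ := this.bddAbove_range
  exact ⟨B, fun n => hB ⟨n, rfl⟩⟩

lemma log_cantorProd {q : ℕ → ℕ} (hq : ∀ n, 0 < q n) (n : ℕ) :
    Real.log (cantorProd q n) = ∑ i ∈ Finset.range n, Real.log (q i) :=
  Real.log_prod fun i _ => by have := hq i; positivity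

lemma le_mul_of_log {a b s C : ℝ} (ha : 0 < a) (hb : 0 < b)
    (h : s * Real.log a ≤ C + Real.log b) : a ^ s ≤ Real.exp C * b := by
  rw [Real.rpow_def_of_pos ha]
  have e : Real.exp C * b = Real.exp (C + Real.log b) := by rw [Real.exp_add, Real.exp_log hb]
  rw [e, mul_comm]
  exact Real.exp_le_exp.2 h

lemma upper_bound (q : ℕ → ℕ) (hq : ∀ n, 2 ≤ q n) (S : Set ℕ)
    (hne : ∀ n, ((Finset.range (q n)).filter (fun m => m ∈ S)).Nonempty)
    {γ s : ℝ} (hγ : 0 ≤ γ) (hs : γ < s)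
    (hm : Tendsto (fun n => Real.log (((Finset.range (q n)).filter (fun m => m ∈ S)).card : ℝ)
      / Real.log (q n)) atTop (nhds γ)) :
    dimH (digitRangeSet q S) ≤ ENNReal.ofReal s := by
  have hL : ∀ i, 0 < Real.log (q i) := fun i =>
    Real.log_pos (by have : (2 : ℝ) ≤ q i := by exact_mod_cast hq i
                     linarith)
  set T : ℕ → Finset ℕ := fun n => (Finset.range (q n)).filter (fun m => m ∈ S) with hT
  obtain ⟨B, hB⟩ := sum_bdd (u := fun i => Real.log ((T i).card : ℝ) - s * Real.log (q i)) (by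
    filter_upwards [hm.eventually_le_const hs] with i hi
    rw [div_le_iff₀ (hL i)] at hi
    exact sub_nonpos.2 hi)
  refine (dimH_mono ?_).trans (upper_generic hq (T := T) (C := Real.exp B) (by linarith) ?_)
  · rintro x ⟨E, hE, hES⟩
    refine ⟨E, hE, fun n => ?_⟩
    simp only [hT, Finset.mem_filter, Finset.mem_range]
    refine ⟨hE.1 n, ?_⟩
    rw [← hES]
    exact ⟨n, rfl⟩
  · intro n
    have hN : ∀ i, 0 < (T i).card := fun i => (hne i).card_pos
    have hM : 0 < cantorProd (fun i => (T i).card) n :=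
      Finset.prod_pos fun i _ => by have := hN i; positivity
    have hP := cantorProd_pos hq n
    have h := hB n
    rw [Finset.sum_sub_distrib, ← Finset.mul_sum,
      ← log_cantorProd (q := q) (fun i => by have := hq i; omega),
      ← log_cantorProd (q := fun i => (T i).card) hN] at h
    have := le_mul_of_log (s := 1) (C := B) hM (Real.rpow_pos_of_pos hP s)
      (by rw [Real.log_rpow hP]; linarith)
    rwa [Real.rpow_one] at this

lemma lower_bound (q : ℕ → ℕ) (hq : ∀ n, 2 ≤ q n)
    (hlim : Tendsto q atTop atTop)
    (hlog : Tendsto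
      (fun n => Real.log (q n) / ∑ i ∈ Finset.range (n + 1), Real.log (q i))
      atTop (nhds 0))
    (S : Set ℕ) (hS : S.Nonempty)
    (hne : ∀ n, ((Finset.range (q n)).filter (fun m => m ∈ S)).Nonempty)
    {γ s : ℝ} (hs0 : 0 < s) (hs : s < γ)
    (hm : Tendsto (fun n => Real.log (((Finset.range (q n)).filter (fun m => m ∈ S)).card : ℝ)
      / Real.log (q n)) atTop (nhds γ)) :
    ENNReal.ofReal s ≤ dimH (digitRangeSet q S) := by
  have hL : ∀ i, 0 < Real.log (q i) := fun i =>
    Real.log_pos (by have : (2 : ℝ) ≤ q i := by exact_mod_cast hq i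
                     linarith)
  set L : ℕ → ℝ := fun i => Real.log (q i) with hLdef
  set Λ : ℕ → ℝ := fun n => ∑ i ∈ Finset.range n, L i with hΛdef
  have hΛpos : ∀ n, 0 < Λ (n + 1) := fun n => Finset.sum_pos (fun i _ => hL i) (by simp)
  have hΛmono : Monotone Λ := monotone_nat_of_le_succ fun n => by
    simp only [hΛdef, Finset.sum_range_succ]
    linarith [hL n]
  have hΛ0 : ∀ n, 0 ≤ Λ n := fun n => Finset.sum_nonneg fun i _ => (hL i).le
  have hlog' : ∀ δ > 0, ∀ᶠ n in atTop, L n ≤ δ * Λ (n + 1) := by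
    intro δ hδ
    filter_upwards [hlog.eventually_le_const hδ] with n hn
    exact (div_le_iff₀ (hΛpos n)).1 hn
  obtain ⟨t, hst, htγ⟩ := exists_between hs
  have ht0 : 0 < t := hs0.trans hst
  set ε : ℝ := (t - s) / (2 * t) with hε
  have hε0 : 0 < ε := div_pos (by linarith) (by linarith)
  have hεt : 2 * t * ε = t - s := by rw [hε]; field_simp
  obtain ⟨d, hd⟩ := S.to_countable.exists_eq_range hS
  obtain ⟨a, ha, haP⟩ := extraction_forall_of_eventually
    (P := fun k n => L n ≤ ε * (1 / 2) ^ (k + 1) * Λ (n + 1) ∧ d k + 1 < q n) (fun k =>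
      (hlog' _ (by positivity)).and (hlim.eventually_gt_atTop _))
  have hinv := Function.leftInverse_invFun ha.injective
  let T : ℕ → Finset ℕ := fun n => if n ∈ Set.range a then {d (Function.invFun a n)}
    else (Finset.range (q n)).filter (fun m => m ∈ S)
  have hTa : ∀ k, T (a k) = {d k} := by
    intro k
    simp only [T, Set.mem_range_self, if_true]
    rw [hinv k]
  have hTn : ∀ n, n ∉ Set.range a → T n = (Finset.range (q n)).filter (fun m => m ∈ S) := by
    intro n hn
    simp only [T, if_neg hn]
  have hTprop : ∀ n, (T n).Nonempty ∧ ∀ e ∈ T n, e < q n ∧ e ∈ S := by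
    intro n
    by_cases hn : n ∈ Set.range a
    · obtain ⟨k, rfl⟩ := hn
      rw [hTa]
      refine ⟨by simp, fun e he => ?_⟩
      rw [Finset.mem_singleton] at he
      subst he
      refine ⟨by have := (haP k).2; omega, ?_⟩
      rw [hd]
      exact ⟨k, rfl⟩
    · rw [hTn n hn]
      refine ⟨hne n, fun e he => ?_⟩
      simpa using he
  have hN : ∀ i, 0 < (T i).card := fun i => (hTprop i).1.card_pos
  -- the sparse positions carry little weight
  have hA : ∀ n, ∑ i ∈ Finset.range n, (if i ∈ Set.range a then L i else 0) ≤ ε * Λ n := by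
    intro n
    rw [← Finset.sum_filter]
    have hsub : (Finset.range n).filter (fun i => i ∈ Set.range a) ⊆
        ((Finset.range n).filter (fun k => a k < n)).image a := by
      intro i hi
      simp only [Finset.mem_filter, Finset.mem_range] at hi
      obtain ⟨hi, k, rfl⟩ := hi
      refine Finset.mem_image_of_mem _ ?_
      simp only [Finset.mem_filter, Finset.mem_range]
      exact ⟨(ha.le_apply (x := k)).trans_lt hi, hi⟩
    refine (Finset.sum_le_sum_of_subset_of_nonneg hsub fun i _ _ => (hL i).le).trans ?_
    rw [Finset.sum_image fun x _ y _ h => ha.injective h]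
    calc ∑ k ∈ (Finset.range n).filter (fun k => a k < n), L (a k)
        ≤ ∑ k ∈ (Finset.range n).filter (fun k => a k < n), ε * (1 / 2) ^ (k + 1) * Λ n := by
          refine Finset.sum_le_sum fun k hk => (haP k).1.trans ?_
          have : Λ (a k + 1) ≤ Λ n := hΛmono (Finset.mem_filter.1 hk).2
          gcongr
      _ ≤ ∑ k ∈ Finset.range n, ε * (1 / 2) ^ (k + 1) * Λ n := by
          refine Finset.sum_le_sum_of_subset_of_nonneg (Finset.filter_subset _ _) fun k _ _ => ?_
          have := hΛ0 n
          positivity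
      _ = ε * Λ n * ∑ k ∈ Finset.range n, (1 / 2 : ℝ) ^ (k + 1) := by
          rw [Finset.mul_sum]
          exact Finset.sum_congr rfl fun k _ => by ring
      _ ≤ ε * Λ n * 1 := by
          have := hΛ0 n
          gcongr
          have hg : ∀ n : ℕ, ∑ k ∈ Finset.range n, (1 / 2 : ℝ) ^ (k + 1) = 1 - (1 / 2) ^ n := by
            intro n
            induction n with
            | zero => simp
            | succ n ih => rw [Finset.sum_range_succ, ih]; ring
          rw [hg]
          have : (0 : ℝ) ≤ (1 / 2) ^ n := by positivity
          linarith
      _ = ε * Λ n := mul_one _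
  obtain ⟨B, hB⟩ := sum_bdd
    (u := fun i => t * (L i - (if i ∈ Set.range a then L i else 0)) - Real.log ((T i).card : ℝ)) (by
    filter_upwards [hm.eventually_const_le htγ] with i hi
    by_cases hi' : i ∈ Set.range a
    · have : 0 ≤ Real.log ((T i).card : ℝ) := Real.log_natCast_nonneg _
      simp only [if_pos hi']
      linarith
    · rw [le_div_iff₀ (hL i)] at hi
      simp only [if_neg hi', hTn i hi', sub_zero]
      exact sub_nonpos.2 hi)
  have hbd : IsBoundedUnder (· ≤ ·) atTop
      (fun n => s * Λ (n + 1) - Real.log (cantorProd (fun i => (T i).card) n)) := by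
    refine ⟨B, ?_⟩
    rw [eventually_map]
    filter_upwards [hlog' ε hε0] with n hn
    have h := hB n
    rw [Finset.sum_sub_distrib, ← Finset.mul_sum, Finset.sum_sub_distrib,
      ← log_cantorProd (q := fun i => (T i).card) hN] at h
    have h1 := hA n
    have h2 : Λ (n + 1) = Λ n + L n := Finset.sum_range_succ _ _
    have h3 : t * (Λ n - ε * Λ n) - Real.log (cantorProd (fun i => (T i).card) n) ≤ B := by
      refine le_trans ?_ h
      have : Λ n = ∑ i ∈ Finset.range n, L i := rfl
      rw [← this]
      gcongr
    have h4 : s * Λ (n + 1) ≤ t * (Λ n - ε * Λ n) := by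
      have e1 : Λ (n + 1) - ε * Λ (n + 1) ≤ Λ n := by linarith
      have e2 := hΛmono (Nat.le_succ n)
      have e3 : t * ε * Λ n ≤ t * ε * Λ (n + 1) := by gcongr
      have e4 : t * (Λ (n + 1) - ε * Λ (n + 1)) ≤ t * Λ n := by gcongr
      have e5 : 2 * t * ε * Λ (n + 1) = (t - s) * Λ (n + 1) := by rw [hεt]
      linarith
    linarith
  obtain ⟨C, hC⟩ := hbd.bddAbove_range
  refine (lower_generic hq (T := T) (fun n e he => ((hTprop n).2 e he).1)
    (fun n => (hTprop n).1) ?_ hs0 (Real.exp_pos C) ?_).trans (dimH_mono ?_)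
  · intro m
    refine ⟨a m, ha.le_apply, fun e he => ?_⟩
    rw [hTa, Finset.mem_singleton] at he
    subst he
    exact (haP m).2
  · intro n
    refine le_mul_of_log (cantorProd_pos hq _)
      (Finset.prod_pos fun i _ => by have := hN i; positivity) ?_
    rw [log_cantorProd (fun i => by have := hq i; omega)]
    have := hC ⟨n, rfl⟩
    simp only at this
    have e : Λ (n + 1) = ∑ i ∈ Finset.range (n + 1), Real.log (q i) := rfl
    rw [← e]
    linarith
  · rintro x ⟨E, hE, hET⟩
    refine ⟨E, hE, ?_⟩
    ext e
    constructor
    · rintro ⟨n, rfl⟩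
      exact ((hTprop n).2 _ (hET n)).2
    · intro he
      rw [hd] at he
      obtain ⟨k, rfl⟩ := he
      refine ⟨a k, ?_⟩
      have := hET (a k)
      rwa [hTa, Finset.mem_singleton] at this

/-- If `q n → ∞`, `log q n / ∑_{i≤n} log q i → 0`, `min S < min Q`, and the
mass dimension of `S` is `γ`, then `dim_H 𝒲_Q(S) = γ`. -/
theorem dimH_digitRangeSet (q : ℕ → ℕ) (hq : ∀ n, 2 ≤ q n)
    (hlim : Tendsto q atTop atTop)
    (hlog : Tendsto
      (fun n => Real.log (q n) / ∑ i ∈ Finset.range (n + 1), Real.log (q i))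
      atTop (nhds 0))
    (S : Set ℕ) (hS : S.Nonempty) (hmin : ∀ n, sInf S < q n) (γ : ℝ)
    (hmass : Tendsto
      (fun n : ℕ => Real.log (((Finset.range n).filter
          (fun m => m ∈ S ∧ 2 * m < n)).card : ℝ) / Real.log n)
      atTop (nhds γ)) :
    dimH (digitRangeSet q S) = ENNReal.ofReal γ := by
  have hm := (mass_lim hmass).comp hlim
  have hγ : 0 ≤ γ := ge_of_tendsto' hmass fun n =>
    div_nonneg (Real.log_natCast_nonneg _) (Real.log_natCast_nonneg _)
  have hne : ∀ n, ((Finset.range (q n)).filter (fun m => m ∈ S)).Nonempty := fun n =>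
    ⟨sInf S, by simpa using ⟨hmin n, Nat.sInf_mem hS⟩⟩
  apply le_antisymm
  · refine ENNReal.le_of_forall_pos_le_add fun ε hε _ => ?_
    have h := upper_bound q hq S hne hγ (s := γ + ε) (by simpa using hε) hm
    rwa [ENNReal.ofReal_add hγ ε.coe_nonneg, ENNReal.ofReal_coe_nnreal] at h
  · refine le_of_forall_lt fun c hc => ?_
    have hct : c ≠ ⊤ := hc.ne_top
    lift c to NNReal using hct
    have hc' : (c : ℝ) < γ := by
      rw [← ENNReal.ofReal_coe_nnreal] at hc
      exact (ENNReal.ofReal_lt_ofReal_iff_of_nonneg c.2).1 hc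
    obtain ⟨s, h1, h2⟩ := exists_between hc'
    have hs0 : 0 < s := lt_of_le_of_lt c.2 h1
    refine lt_of_lt_of_le ?_ (lower_bound q hq hlim hlog S hS hne hs0 h2 hm)
    rw [← ENNReal.ofReal_coe_nnreal]
    exact (ENNReal.ofReal_lt_ofReal_iff hs0).2 h1
end
end
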